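/- Let N be a positive integer, L > 0, t > 0, and let X be a finite index set. For each x ∈ X let f_x : U(N) → ℝ be L-Lipschitz with respect to the Frobenius norm, i.e. |f_x(U) − f_x(V)| ≤ L·‖U − V‖_F for all U, V ∈ U(N). Then, for U and U' sampled independently from the Haar probability measure μ_N, (μ_N × μ_N)({(U,U') : ∃ x ∈ X with |f_x(U) − f_x(U')| ≥ t}) ≤ 2·|X|·exp(−(N−2)·t² / (48·L²)). -/

import Mathlib

open MeasureTheory

/-- The Frobenius norm `‖M‖_F = sqrt (∑_{i,j} |M i j|²)` of a complex matrix. -/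
noncomputable def frobNorm {m n : Type*} [Fintype m] [Fintype n]
    (M : Matrix m n ℂ) : ℝ :=
  Real.sqrt (∑ i, ∑ j, ‖M i j‖ ^ 2)

namespace UConc
open Matrix
section
open scoped Matrix.Norms.Frobenius

/-- Square complex matrices. -/
abbrev Mt (N : ℕ) := Matrix (Fin N) (Fin N) ℂ
/-- The unitary group. -/
abbrev UG (N : ℕ) := Matrix.unitaryGroup (Fin N) ℂ

variable {N : ℕ}

lemma fnorm_sq (A : Mt N) : ‖A‖ ^ 2 = ∑ i, ∑ j, ‖A i j‖ ^ 2 := by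
  have h0 : 0 ≤ ∑ i, ∑ j, ‖A i j‖ ^ 2 :=
    Finset.sum_nonneg fun i _ => Finset.sum_nonneg fun j _ => by positivity
  rw [frobenius_norm_def, ← Real.sqrt_eq_rpow]
  simp only [Real.rpow_ofNat]
  exact Real.sq_sqrt h0

lemma frobNorm_eq (A : Mt N) : frobNorm A = ‖A‖ := by
  rw [frobNorm, ← fnorm_sq, Real.sqrt_sq (norm_nonneg _)]

/-- Real Frobenius inner product. -/
noncomputable def ip (A B : Mt N) : ℝ := (trace (Aᴴ * B)).re

lemma ip_eq_sum (A B : Mt N) :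
    ip A B = ∑ i, ∑ j, ((A i j).re * (B i j).re + (A i j).im * (B i j).im) := by
  rw [ip, trace]
  simp only [Matrix.diag_apply, Matrix.mul_apply, conjTranspose_apply, Complex.re_sum]
  rw [Finset.sum_comm]
  refine Finset.sum_congr rfl fun i _ => Finset.sum_congr rfl fun j _ => ?_
  simp

lemma ip_self (A : Mt N) : ip A A = ‖A‖ ^ 2 := by
  rw [ip_eq_sum, fnorm_sq]
  refine Finset.sum_congr rfl fun i _ => Finset.sum_congr rfl fun j _ => ?_
  rw [Complex.sq_norm, Complex.normSq_apply]

lemma ip_comm (A B : Mt N) : ip A B = ip B A := by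
  rw [ip_eq_sum, ip_eq_sum]
  refine Finset.sum_congr rfl fun i _ => Finset.sum_congr rfl fun j _ => ?_
  ring

lemma ip_add_right (A B C : Mt N) : ip A (B + C) = ip A B + ip A C := by
  simp [ip, mul_add]
lemma ip_sub_right (A B C : Mt N) : ip A (B - C) = ip A B - ip A C := by
  simp [ip, mul_sub]
lemma ip_add_left (A B C : Mt N) : ip (A + B) C = ip A C + ip B C := by
  simp [ip, add_mul]
lemma ip_sub_left (A B C : Mt N) : ip (A - B) C = ip A C - ip B C := by
  simp [ip, sub_mul]
lemma ip_smul_right (r : ℝ) (A B : Mt N) : ip A (r • B) = r * ip A B := by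
  simp [ip]

lemma U_mul_star (U : UG N) : (U : Mt N) * (U : Mt N)ᴴ = 1 := by
  exact Unitary.coe_mul_star_self U
lemma star_U_mul (U : UG N) : (U : Mt N)ᴴ * (U : Mt N) = 1 := by
  exact Unitary.coe_star_mul_self U
lemma coe_inv_U (U : UG N) : ((U⁻¹ : UG N) : Mt N) = (U : Mt N)ᴴ := rfl

lemma norm_U_mul (U : UG N) (A : Mt N) : ‖(U : Mt N) * A‖ = ‖A‖ := by
  have : ‖(U : Mt N) * A‖ ^ 2 = ‖A‖ ^ 2 := by
    rw [← ip_self, ← ip_self, ip, ip, conjTranspose_mul, Matrix.mul_assoc,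
      ← Matrix.mul_assoc _ (U : Mt N) A, star_U_mul, Matrix.one_mul]
  exact (sq_eq_sq₀ (norm_nonneg _) (norm_nonneg _)).1 this

lemma norm_mul_U (U : UG N) (A : Mt N) : ‖A * (U : Mt N)‖ = ‖A‖ := by
  rw [← norm_star, star_eq_conjTranspose, conjTranspose_mul, ← coe_inv_U, norm_U_mul,
    ← star_eq_conjTranspose, norm_star]

lemma norm_mul_Us (U : UG N) (A : Mt N) : ‖A * (U : Mt N)ᴴ‖ = ‖A‖ := by
  rw [← coe_inv_U, norm_mul_U]
lemma norm_Us_mul (U : UG N) (A : Mt N) : ‖(U : Mt N)ᴴ * A‖ = ‖A‖ := by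
  rw [← coe_inv_U, norm_U_mul]

lemma norm_U (U : UG N) : ‖(U : Mt N)‖ ≤ N := by
  have h : ‖(U : Mt N)‖ ^ 2 = N := by
    rw [← ip_self, ip, star_U_mul]; simp
  have hN : (N : ℝ) ≤ N ^ 2 := by exact_mod_cast Nat.le_self_pow (by norm_num) N
  nlinarith [norm_nonneg (U : Mt N), Nat.cast_nonneg (α := ℝ) N]

instance : CompactSpace (UG N) := by
  have hc : IsClosed ((Matrix.unitaryGroup (Fin N) ℂ : Submonoid (Mt N)) : Set (Mt N)) := by
    have : ((Matrix.unitaryGroup (Fin N) ℂ : Submonoid (Mt N)) : Set (Mt N))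
        = {A | A * star A = 1} := by
      ext A; simp [Matrix.mem_unitaryGroup_iff]
    rw [this]
    exact isClosed_eq (by fun_prop) continuous_const
  refine isCompact_iff_compactSpace.1 (Metric.isCompact_of_isClosed_isBounded hc ?_)
  refine (Metric.isBounded_closedBall (x := (0 : Mt N)) (r := N)).subset ?_
  intro U hU
  simpa using norm_U ⟨U, hU⟩

instance : SecondCountableTopology (Mt N) :=
  inferInstanceAs (SecondCountableTopology (Fin N → Fin N → ℂ))

instance : SecondCountableTopology (UG N) :=
  TopologicalSpace.Subtype.secondCountableTopology
    ((Matrix.unitaryGroup (Fin N) ℂ : Submonoid (Mt N)) : Set (Mt N))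

lemma cont_norm : Continuous (fun A : Mt N => ‖A‖) := continuous_norm

lemma cont_coe : Continuous (fun U : UG N => (U : Mt N)) := continuous_subtype_val

section Haar
set_option linter.unusedSectionVars false
variable [MeasurableSpace (UG N)] [BorelSpace (UG N)]
  (μ : Measure (UG N)) [IsProbabilityMeasure μ]

lemma ci {E : Type*} [NormedAddCommGroup E] {f : UG N → E} (hf : Continuous f) : Integrable f μ := by
  exact hf.integrable_of_hasCompactSupport (HasCompactSupport.of_compactSpace f)

variable [μ.IsMulLeftInvariant]

lemma isHaar : μ.IsHaarMeasure :=
  Measure.isHaarMeasure_of_isCompact_nonempty_interior μ Set.univ isCompact_univ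
    (by simp) (by simp) (by simp)

lemma isRight : μ.IsMulRightInvariant := by
  have := isHaar μ
  refine ⟨fun g => ?_⟩
  have hp : IsProbabilityMeasure (Measure.map (fun x => x * g) μ) :=
    Measure.isProbabilityMeasure_map (by fun_prop)
  have h := Measure.isMulInvariant_eq_smul_of_compactSpace (Measure.map (fun x => x * g) μ) μ
  have h2 := congrArg (fun ν : Measure (UG N) => ν Set.univ) h
  simp only [Measure.smul_apply, measure_univ] at h2
  have h3 : (Measure.map (fun x => x * g) μ).haarScalarFactor μ = 1 := by
    simpa [ENNReal.smul_def] using h2.symm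
  rw [h3, one_smul] at h
  exact h

lemma int_left (a : UG N) (f : UG N → ℝ) : ∫ V, f (a * V) ∂μ = ∫ V, f V ∂μ :=
  integral_mul_left_eq_self f a
lemma int_right (a : UG N) (f : UG N → ℝ) : ∫ V, f (V * a) ∂μ = ∫ V, f V ∂μ := by
  have := isRight μ
  exact integral_mul_right_eq_self f a

end Haar


/-! ### Diagonal and permutation unitaries -/

lemma diag_mem (φ : Fin N → ℂ) (h : ∀ k, ‖φ k‖ = 1) :
    Matrix.diagonal φ ∈ Matrix.unitaryGroup (Fin N) ℂ := by
  rw [Matrix.mem_unitaryGroup_iff, star_eq_conjTranspose, Matrix.diagonal_conjTranspose,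
    Matrix.diagonal_mul_diagonal, ← Matrix.diagonal_one]
  congr 1
  funext k
  have := Complex.mul_conj (φ k)
  simp only [Pi.star_apply, RCLike.star_def, this, Complex.normSq_eq_norm_sq, h k]
  simp

/-- Permutation matrix as a unitary. -/
noncomputable def pu (σ : Equiv.Perm (Fin N)) : UG N :=
  ⟨(1 : Mt N).submatrix σ id, by
    rw [Matrix.mem_unitaryGroup_iff, star_eq_conjTranspose, conjTranspose_submatrix,
      conjTranspose_one]
    have := Matrix.submatrix_mul_equiv (1 : Mt N) (1 : Mt N) σ (Equiv.refl _) σ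
    rw [Matrix.one_mul] at this
    simpa using this⟩

lemma pu_mul (σ : Equiv.Perm (Fin N)) (V : UG N) (i j : Fin N) :
    ((pu σ * V : UG N) : Mt N) i j = (V : Mt N) (σ i) j := by
  change (((1 : Mt N).submatrix σ id) * (V : Mt N)) i j = _
  simp [Matrix.mul_apply, Matrix.one_apply]

lemma mul_pu (σ : Equiv.Perm (Fin N)) (V : UG N) (i j : Fin N) :
    ((V * pu σ : UG N) : Mt N) i j = (V : Mt N) i (σ⁻¹ j) := by
  change ((V : Mt N) * ((1 : Mt N).submatrix σ id)) i j = _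
  rw [Matrix.mul_apply, Finset.sum_eq_single (σ⁻¹ j)]
  · simp [Matrix.one_apply]
  · intro k _ hk
    have : σ k ≠ j := fun h => hk (by rw [← h]; simp)
    simp [this]
  · simp

lemma exists_perm {a b i j : Fin N} (hab : a ≠ b) (hij : i ≠ j) :
    ∃ σ : Equiv.Perm (Fin N), σ a = i ∧ σ b = j := by
  refine ⟨Equiv.swap ((Equiv.swap a i) b) j * Equiv.swap a i, ?_, ?_⟩
  · have h1 : (Equiv.swap a i) b ≠ i := by
      intro h
      have := (Equiv.swap a i).injective (h.trans (Equiv.swap_apply_left a i).symm)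
      exact hab this.symm
    simp [Equiv.swap_apply_of_ne_of_ne h1.symm hij]
  · simp

/-! ### Spectral theorem for skew-Hermitian matrices -/

lemma conj_mul_conj (Q : UG N) (A B : Mt N) :
    ((Q : Mt N) * A * (Q : Mt N)ᴴ) * ((Q : Mt N) * B * (Q : Mt N)ᴴ)
      = (Q : Mt N) * (A * B) * (Q : Mt N)ᴴ := by
  simp only [Matrix.mul_assoc]
  rw [← Matrix.mul_assoc (Q : Mt N)ᴴ (Q : Mt N), star_U_mul, Matrix.one_mul]

lemma trace_conj (Q : UG N) (A : Mt N) :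
    trace ((Q : Mt N) * A * (Q : Mt N)ᴴ) = trace A := by
  rw [Matrix.trace_mul_comm, ← Matrix.mul_assoc, star_U_mul, Matrix.one_mul]

lemma ip_conj (Q : UG N) (A B : Mt N) :
    ip ((Q : Mt N) * A * (Q : Mt N)ᴴ) ((Q : Mt N) * B * (Q : Mt N)ᴴ) = ip A B := by
  rw [ip, ip]
  have : ((Q : Mt N) * A * (Q : Mt N)ᴴ)ᴴ = (Q : Mt N) * Aᴴ * (Q : Mt N)ᴴ := by
    simp [conjTranspose_mul, Matrix.mul_assoc]
  rw [this, conj_mul_conj, trace_conj]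

lemma norm_diagI_sq (h : Fin N → ℝ) :
    ‖(Matrix.diagonal (fun k => Complex.I * (h k : ℂ)) : Mt N)‖ ^ 2 = ∑ k, h k ^ 2 := by
  rw [fnorm_sq]
  refine Finset.sum_congr rfl fun i _ => ?_
  rw [Finset.sum_eq_single i]
  · simp
  · intro j _ hj; simp [Matrix.diagonal_apply_ne _ hj.symm]
  · simp

lemma skew_diag (K : Mt N) (hK : Kᴴ = -K) : ∃ (Q : UG N) (h : Fin N → ℝ),
    K = (Q : Mt N) * Matrix.diagonal (fun k => Complex.I * (h k : ℂ)) * (Q : Mt N)ᴴ ∧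
    (trace K = 0 → ∑ k, h k = 0) ∧ ‖K‖ ^ 2 = ∑ k, h k ^ 2 := by
  have hH : (((-Complex.I) • K : Mt N)).IsHermitian := by
    rw [Matrix.IsHermitian, conjTranspose_smul, hK]; simp
  have hs := hH.spectral_theorem
  set Q := hH.eigenvectorUnitary
  have e : K = (Q : Mt N) * Matrix.diagonal (fun k => Complex.I * (hH.eigenvalues k : ℂ))
      * (Q : Mt N)ᴴ := by
    have h1 : K = Complex.I • ((-Complex.I) • K) := by rw [smul_smul]; simp
    refine h1.trans ((congrArg (fun Z => Complex.I • Z) hs).trans ?_)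
    beta_reduce
    rw [Unitary.conjStarAlgAut_apply]
    have h2 : (Matrix.diagonal (fun k => Complex.I * (hH.eigenvalues k : ℂ)) : Mt N)
      = Complex.I • Matrix.diagonal (RCLike.ofReal ∘ hH.eigenvalues) := by
      rw [← Matrix.diagonal_smul]; rfl
    rw [h2, Matrix.mul_smul, Matrix.smul_mul]
    rfl
  refine ⟨Q, hH.eigenvalues, e, ?_, ?_⟩
  · intro h0
    rw [e, trace_conj, Matrix.trace_diagonal, ← Finset.mul_sum] at h0
    have := (mul_eq_zero.1 h0).resolve_left Complex.I_ne_zero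
    exact_mod_cast this
  · have : ‖K‖ ^ 2 = ‖(Q : Mt N) * Matrix.diagonal (fun k => Complex.I * (hH.eigenvalues k : ℂ))
      * (Q : Mt N)ᴴ‖ ^ 2 := by rw [← e]
    rw [this, norm_mul_Us, norm_U_mul, norm_diagI_sq]

/-! ### The random direction and the random step -/

section Step
variable (a b : Fin N)

/-- A vector supported on the two chosen indices. -/
noncomputable def w2 (x y z : ℂ) : Fin N → ℂ := fun k => if k = a then x else if k = b then y else z

/-- random direction -/
noncomputable def Xd (V : UG N) : Mt N :=
  (V : Mt N) * Matrix.diagonal (w2 a b Complex.I (-Complex.I) 0) * (V : Mt N)ᴴ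
/-- random projection -/
noncomputable def Yd (V : UG N) : Mt N :=
  (V : Mt N) * Matrix.diagonal (w2 a b 1 1 0) * (V : Mt N)ᴴ

/-- The cosine belonging to the sine `s`. -/
noncomputable def cs (s : ℝ) : ℝ := Real.sqrt (1 - s ^ 2)

/-- The diagonal unitary step. -/
noncomputable def Du (s : ℝ) (hs : s ^ 2 ≤ 1) : UG N :=
  ⟨Matrix.diagonal (w2 a b (cs s + s * Complex.I) (cs s - s * Complex.I) 1), by
    apply diag_mem
    have hc : cs s ^ 2 + s ^ 2 = 1 := by
      rw [cs, Real.sq_sqrt (by linarith)]; ring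
    intro k
    have key : ∀ z : ℂ, z.re ^ 2 + z.im ^ 2 = 1 → ‖z‖ = 1 := by
      intro z hz
      have : ‖z‖ ^ 2 = 1 := by rw [Complex.sq_norm, Complex.normSq_apply]; linarith
      nlinarith [norm_nonneg z]
    apply key
    unfold w2
    split_ifs <;> simp <;> linarith⟩

/-- The random step. -/
noncomputable def Su (s : ℝ) (hs : s ^ 2 ≤ 1) (V : UG N) : UG N := V * Du a b s hs * V⁻¹

variable {a b}

lemma Su_conj (s : ℝ) (hs : s ^ 2 ≤ 1) (W V : UG N) :
    Su a b s hs (W * V) = W * Su a b s hs V * W⁻¹ := by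
  simp [Su, mul_assoc]

lemma Su_cont (s : ℝ) (hs : s ^ 2 ≤ 1) : Continuous (Su a b s hs) := by
  unfold Su; fun_prop

lemma Xd_cont : Continuous (Xd a b : UG N → Mt N) := by
  unfold Xd
  have := cont_coe (N := N)
  fun_prop

lemma Xd_conj (W V : UG N) : Xd a b (W * V) = (W : Mt N) * Xd a b V * (W : Mt N)ᴴ := by
  simp [Xd, Matrix.mul_assoc]

lemma Du_eq (s : ℝ) (hs : s ^ 2 ≤ 1) :
    ((Du a b s hs : UG N) : Mt N) = 1 + (s : ℂ) • Matrix.diagonal (w2 a b Complex.I (-Complex.I) 0)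
      + ((cs s : ℂ) - 1) • Matrix.diagonal (w2 a b 1 1 0) := by
  rw [← Matrix.diagonal_one, ← Matrix.diagonal_smul, ← Matrix.diagonal_smul, Matrix.diagonal_add,
    Matrix.diagonal_add]
  change Matrix.diagonal _ = _
  congr 1
  funext k
  simp only [w2, Pi.smul_apply, smul_eq_mul]
  split_ifs <;> ring

lemma Su_eq (hab : a ≠ b) (s : ℝ) (hs : s ^ 2 ≤ 1) (V : UG N) :
    (Su a b s hs V : Mt N) = 1 + (s : ℂ) • Xd a b V + ((cs s : ℂ) - 1) • Yd a b V := by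
  have : (Su a b s hs V : Mt N) = (V : Mt N) * (Du a b s hs : UG N) * (V : Mt N)ᴴ := rfl
  rw [this, Du_eq, Xd, Yd, Matrix.mul_add, Matrix.mul_add, Matrix.add_mul, Matrix.add_mul,
    Matrix.mul_one, U_mul_star, Matrix.mul_smul, Matrix.mul_smul, Matrix.smul_mul, Matrix.smul_mul]

lemma norm_w2_sq (hab : a ≠ b) (x y : ℂ) :
    ‖(Matrix.diagonal (w2 a b x y 0) : Mt N)‖ ^ 2 = ‖x‖ ^ 2 + ‖y‖ ^ 2 := by
  rw [fnorm_sq]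
  have : ∀ i, ∑ j, ‖(Matrix.diagonal (w2 a b x y 0) : Mt N) i j‖ ^ 2 = ‖w2 a b x y 0 i‖ ^ 2 := by
    intro i
    rw [Finset.sum_eq_single i]
    · simp
    · intro j _ hj; simp [Matrix.diagonal_apply_ne _ hj.symm]
    · simp
  simp_rw [this]
  rw [← Finset.add_sum_erase _ _ (Finset.mem_univ a), ← Finset.add_sum_erase _ _
    (Finset.mem_erase.2 ⟨hab.symm, Finset.mem_univ b⟩), Finset.sum_eq_zero]
  · simp [w2, hab.symm]
  · intro k hk
    simp only [Finset.mem_erase, Finset.mem_univ, and_true] at hk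
    simp [w2, hk.1, hk.2]

lemma norm_Xd_sq (hab : a ≠ b) (V : UG N) : ‖Xd a b V‖ ^ 2 = 2 := by
  rw [Xd, norm_mul_Us, norm_U_mul, norm_w2_sq hab]; norm_num
lemma norm_Yd_sq (hab : a ≠ b) (V : UG N) : ‖Yd a b V‖ ^ 2 = 2 := by
  rw [Yd, norm_mul_Us, norm_U_mul, norm_w2_sq hab]; norm_num

lemma cs_bd (s : ℝ) (hs : s ^ 2 ≤ 1) : 0 ≤ 1 - cs s ∧ 1 - cs s ≤ s ^ 2 := by
  have h0 : 0 ≤ cs s := Real.sqrt_nonneg _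
  have h1 : cs s ^ 2 = 1 - s ^ 2 := Real.sq_sqrt (by linarith)
  constructor <;> nlinarith [sq_nonneg s]

lemma Su_rem (hab : a ≠ b) (s : ℝ) (hs : s ^ 2 ≤ 1) (V : UG N) :
    ‖(Su a b s hs V : Mt N) - 1 - (s : ℂ) • Xd a b V‖ ≤ 2 * s ^ 2 := by
  rw [Su_eq hab]
  have : 1 + (s : ℂ) • Xd a b V + ((cs s : ℂ) - 1) • Yd a b V - 1 - (s : ℂ) • Xd a b V
    = ((cs s : ℂ) - 1) • Yd a b V := by abel
  rw [this, norm_smul]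
  have h1 : ‖((cs s : ℂ) - 1)‖ = 1 - cs s := by
    rw [← Complex.ofReal_one, ← Complex.ofReal_sub, Complex.norm_real, Real.norm_eq_abs, abs_sub_comm,
      abs_of_nonneg (cs_bd s hs).1]
  have h2 : ‖Yd a b V‖ ≤ 2 := by nlinarith [norm_Yd_sq hab V, norm_nonneg (Yd a b V)]
  rw [h1]
  have := cs_bd s hs
  nlinarith [norm_nonneg (Yd a b V)]

lemma Su_sub_one (hab : a ≠ b) (s : ℝ) (hs : s ^ 2 ≤ 1) (hs0 : 0 ≤ s) (V : UG N) :
    ‖(Su a b s hs V : Mt N) - 1‖ ≤ 4 * s := by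
  have h1 := Su_rem hab s hs V
  have h2 : ‖Xd a b V‖ ≤ 2 := by nlinarith [norm_Xd_sq hab V, norm_nonneg (Xd a b V)]
  have h3 : ‖(s : ℂ) • Xd a b V‖ ≤ 2 * s := by
    rw [norm_smul, Complex.norm_real, Real.norm_eq_abs, abs_of_nonneg hs0]; nlinarith
  have h4 := norm_add_le ((Su a b s hs V : Mt N) - 1 - (s : ℂ) • Xd a b V) ((s : ℂ) • Xd a b V)
  rw [sub_add_cancel] at h4
  nlinarith

lemma Xd_skew (V : UG N) : (Xd a b V)ᴴ = - Xd a b V := by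
  rw [Xd, conjTranspose_mul, conjTranspose_mul, conjTranspose_conjTranspose, diagonal_conjTranspose,
    ← Matrix.mul_assoc, ← Matrix.neg_mul, ← Matrix.mul_neg, Matrix.diagonal_neg]
  congr 3
  funext k
  simp only [w2, Pi.star_apply, Pi.neg_apply]
  split_ifs <;> simp

lemma Xd_trace (hab : a ≠ b) (V : UG N) : trace (Xd a b V) = 0 := by
  rw [Xd, trace_conj, Matrix.trace_diagonal, ← Finset.add_sum_erase _ _ (Finset.mem_univ a),
    ← Finset.add_sum_erase _ _ (Finset.mem_erase.2 ⟨hab.symm, Finset.mem_univ b⟩),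
    Finset.sum_eq_zero]
  · simp [w2, hab.symm]
  · intro k hk
    simp only [Finset.mem_erase, Finset.mem_univ, and_true] at hk
    simp [w2, hk.1, hk.2]

lemma w2_entry (hab : a ≠ b) (x y : ℂ) (V : UG N) (i j : Fin N) :
    ((V : Mt N) * Matrix.diagonal (w2 a b x y 0) * (V : Mt N)ᴴ) i j
      = x * ((V : Mt N) i a * star ((V : Mt N) j a)) + y * ((V : Mt N) i b * star ((V : Mt N) j b)) := by
  rw [Matrix.mul_apply]
  simp only [Matrix.mul_diagonal, conjTranspose_apply]
  rw [← Finset.add_sum_erase _ _ (Finset.mem_univ a),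
    ← Finset.add_sum_erase _ _ (Finset.mem_erase.2 ⟨hab.symm, Finset.mem_univ b⟩),
    Finset.sum_eq_zero]
  · simp only [w2, if_true, hab.symm, if_false]; ring
  · intro k hk
    simp only [Finset.mem_erase, Finset.mem_univ, and_true] at hk
    simp [w2, hk.1, hk.2]

end Step


/-! ### Second moments of the random direction -/

section Moments
set_option linter.unusedSectionVars false
variable [MeasurableSpace (UG N)] [BorelSpace (UG N)]
  (μ : Measure (UG N)) [IsProbabilityMeasure μ] [μ.IsMulLeftInvariant]
variable {a b : Fin N}

variable (a b) in
/-- Diagonal entries of the random direction. -/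
noncomputable def yv (V : UG N) (j : Fin N) : ℝ := ‖(V : Mt N) j a‖ ^ 2 - ‖(V : Mt N) j b‖ ^ 2

lemma ent_cont (i j : Fin N) : Continuous (fun V : UG N => (V : Mt N) i j) :=
  (cont_coe (N := N)).matrix_elem i j

lemma yv_cont (j : Fin N) : Continuous (fun V : UG N => yv a b V j) := by
  unfold yv
  exact ((ent_cont j a).norm.pow 2).sub ((ent_cont j b).norm.pow 2)

variable (a b) in
/-- The isotropy constant. -/
noncomputable def qc : ℝ := ∫ V, (yv a b V a ^ 2 - yv a b V a * yv a b V b) ∂μ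

lemma Xd_diag (hab : a ≠ b) (V : UG N) (j : Fin N) : Xd a b V j j = Complex.I * (yv a b V j : ℂ) := by
  rw [Xd, w2_entry hab, yv]
  simp only [RCLike.star_def, Complex.mul_conj, Complex.normSq_eq_norm_sq]
  push_cast; ring

lemma ip_diagI (h : Fin N → ℝ) (M : Mt N) :
    ip (Matrix.diagonal (fun k => Complex.I * (h k : ℂ))) M = ∑ k, h k * (M k k).im := by
  rw [ip, diagonal_conjTranspose, Matrix.trace]
  simp only [Matrix.diag_apply, Matrix.diagonal_mul, Complex.re_sum]
  refine Finset.sum_congr rfl fun i _ => ?_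
  simp

lemma yy_int (σ : Equiv.Perm (Fin N)) (i j : Fin N) :
    ∫ V, yv a b V (σ i) * yv a b V (σ j) ∂μ = ∫ V, yv a b V i * yv a b V j ∂μ := by
  rw [← int_left μ (pu σ) (fun V => yv a b V i * yv a b V j)]
  simp only [yv, pu_mul]

lemma iso_diag (hab : a ≠ b) (h : Fin N → ℝ) (h0 : ∑ k, h k = 0) :
    ∫ V, (∑ k, h k * yv a b V k) ^ 2 ∂μ = qc μ a b * ∑ k, h k ^ 2 := by
  set p := ∫ V, yv a b V a * yv a b V a ∂μ with hp
  set r := ∫ V, yv a b V a * yv a b V b ∂μ with hr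
  have hc : ∀ i j, Continuous fun V : UG N => yv a b V i * yv a b V j := fun i j =>
    (yv_cont i).mul (yv_cont j)
  have hq : qc μ a b = p - r := by
    rw [qc, hp, hr, ← integral_sub (ci μ (hc _ _)) (ci μ (hc _ _))]
    simp only [sq]
  have hE : ∀ i j, ∫ V, yv a b V i * yv a b V j ∂μ = r + if i = j then p - r else 0 := by
    intro i j
    split_ifs with hij
    · subst hij
      have := yy_int μ (a := a) (b := b) (Equiv.swap a i) a a
      rw [Equiv.swap_apply_left] at this
      rw [this]; ring
    · obtain ⟨σ, h1, h2⟩ := exists_perm hab hij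
      have := yy_int μ (a := a) (b := b) σ a b
      rw [h1, h2] at this
      rw [this]; ring
  have e1 : ∀ V : UG N, (∑ k, h k * yv a b V k) ^ 2
      = ∑ i, ∑ j, (h i * h j) * (yv a b V i * yv a b V j) := by
    intro V
    rw [sq, Finset.sum_mul_sum]
    refine Finset.sum_congr rfl fun i _ => Finset.sum_congr rfl fun j _ => by ring
  simp_rw [e1]
  rw [integral_finsetSum _ (fun i _ => ci μ (by have := hc; fun_prop))]
  have e2 : ∀ i, ∫ V, ∑ j, (h i * h j) * (yv a b V i * yv a b V j) ∂μ
      = ∑ j, (h i * h j) * (r + if i = j then p - r else 0) := by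
    intro i
    rw [integral_finsetSum _ (fun j _ => ci μ ((hc i j).const_mul _))]
    refine Finset.sum_congr rfl fun j _ => ?_
    rw [integral_const_mul, hE]
  simp_rw [e2, mul_add, Finset.sum_add_distrib]
  have e3 : ∑ i, ∑ j, h i * h j * r = 0 := by
    have : ∑ i, ∑ j, h i * h j * r = (∑ i, h i) * (∑ j, h j) * r := by
      rw [Finset.sum_mul_sum, Finset.sum_mul]
      refine Finset.sum_congr rfl fun i _ => ?_
      rw [Finset.sum_mul]
    rw [this, h0]; ring
  rw [e3, hq, Finset.mul_sum, zero_add]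
  refine Finset.sum_congr rfl fun i _ => ?_
  simp; ring

lemma iso (hab : a ≠ b) (K : Mt N) (hK : Kᴴ = -K) (hK0 : trace K = 0) :
    ∫ V, (ip K (Xd a b V)) ^ 2 ∂μ = qc μ a b * ‖K‖ ^ 2 := by
  obtain ⟨Q, h, e, h0, hn⟩ := skew_diag K hK
  rw [hn, ← iso_diag μ hab h (h0 hK0), ← int_left μ Q]
  refine integral_congr_ae (.of_forall fun V => ?_)
  beta_reduce
  rw [Xd_conj, e, ip_conj, ip_diagI]
  simp [Xd_diag hab]

lemma ip_single (i j : Fin N) (c : ℂ) (M : Mt N) :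
    ip (Matrix.single i j c) M = (star c * M i j).re := by
  rw [ip, Matrix.conjTranspose_single, Matrix.trace_single_mul, smul_eq_mul]

lemma off_diag (hab : a ≠ b) {i j : Fin N} (hij : i ≠ j) :
    ∫ V, ‖Xd a b V i j‖ ^ 2 ∂μ = qc μ a b := by
  set K1 : Mt N := Matrix.single i j 1 - Matrix.single j i 1 with hK1
  set K2 : Mt N := Matrix.single i j Complex.I + Matrix.single j i Complex.I with hK2
  have hX : ∀ V : UG N, Xd a b V j i = - star (Xd a b V i j) := by
    intro V
    have := congrFun (congrFun (Xd_skew (a := a) (b := b) V) j) i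
    rw [conjTranspose_apply] at this
    rw [this]; simp
  have i1 : ∀ V : UG N, ip K1 (Xd a b V) = 2 * (Xd a b V i j).re := by
    intro V
    rw [hK1, ip_sub_left, ip_single, ip_single, hX]; simp; ring
  have i2 : ∀ V : UG N, ip K2 (Xd a b V) = 2 * (Xd a b V i j).im := by
    intro V
    rw [hK2, ip_add_left, ip_single, ip_single, hX]; simp; ring
  have n1 : ‖K1‖ ^ 2 = 2 := by
    rw [← ip_self]
    nth_rewrite 1 [hK1]
    rw [ip_sub_left, ip_single, ip_single, hK1]
    simp [hij, hij.symm]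
    norm_num
  have n2 : ‖K2‖ ^ 2 = 2 := by
    rw [← ip_self]
    nth_rewrite 1 [hK2]
    rw [ip_add_left, ip_single, ip_single, hK2]
    simp [hij, hij.symm]
    norm_num
  have m1 := iso μ hab K1 (by simp [hK1, Matrix.conjTranspose_single])
    (by simp [hK1, Matrix.trace_single_eq_of_ne, hij, hij.symm])
  have m2 := iso μ hab K2 (by simp [hK2, Matrix.conjTranspose_single, Matrix.single_neg])
    (by simp [hK2, Matrix.trace_single_eq_of_ne, hij, hij.symm])
  simp_rw [i1] at m1
  simp_rw [i2] at m2
  have hXc : Continuous fun V : UG N => Xd a b V i j := Xd_cont.matrix_elem i j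
  have : ∀ V : UG N, ‖Xd a b V i j‖ ^ 2
      = (1/4) * (2 * (Xd a b V i j).re) ^ 2 + (1/4) * (2 * (Xd a b V i j).im) ^ 2 := by
    intro V; rw [Complex.sq_norm, Complex.normSq_apply]; ring
  simp_rw [this]
  rw [integral_add (ci μ (by fun_prop)) (ci μ (by fun_prop)), integral_const_mul, integral_const_mul,
    m1, m2, n1, n2]
  ring

lemma qc_pos (hab : a ≠ b) : 0 < qc μ a b := by
  have := isHaar μ
  set h : Fin N → ℝ := fun k => if k = a then 1 else if k = b then -1 else 0 with hh
  have hs : ∀ u : Fin N → ℝ, ∑ k, h k * u k = u a - u b := by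
    intro u
    rw [← Finset.add_sum_erase _ _ (Finset.mem_univ a),
    ← Finset.add_sum_erase _ _ (Finset.mem_erase.2 ⟨hab.symm, Finset.mem_univ b⟩),
    Finset.sum_eq_zero]
    · simp [hh, hab.symm]; ring
    · intro k hk
      simp only [Finset.mem_erase, Finset.mem_univ, and_true] at hk
      simp [hh, hk.1, hk.2]
  have h0 : ∑ k, h k = 0 := by simpa using hs (fun _ => 1)
  have h2 : ∑ k, h k ^ 2 = 2 := by
    simp_rw [sq]; rw [hs]; simp [hh, hab.symm]; norm_num
  have e := iso_diag μ hab h h0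
  rw [h2] at e
  simp_rw [hs] at e
  have hc : Continuous fun V : UG N => (yv a b V a - yv a b V b) ^ 2 :=
    ((yv_cont a).sub (yv_cont b)).pow 2
  have : 0 < ∫ V, (yv a b V a - yv a b V b) ^ 2 ∂μ := by
    refine hc.integral_pos_of_hasCompactSupport_nonneg_nonzero (HasCompactSupport.of_compactSpace _)
      (fun V => sq_nonneg _) (x := 1) ?_
    simp [yv, hab, hab.symm]
  linarith

lemma S_off (hab : a ≠ b) (s : ℝ) (hs : s ^ 2 ≤ 1) {i j : Fin N} (hij : i ≠ j) :
    s ^ 2 * qc μ a b ≤ ∫ V, ‖(Su a b s hs V : Mt N) i j‖ ^ 2 ∂μ := by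
  have hSc : Continuous fun V : UG N => (Su a b s hs V : Mt N) i j :=
    (cont_coe.comp (Su_cont s hs)).matrix_elem i j
  have hXc : Continuous fun V : UG N => Xd a b V i j := Xd_cont.matrix_elem i j
  set τ := pu (Equiv.swap a b) with hτ
  have hS : ∀ V : UG N, (Su a b s hs V : Mt N) i j
      = (s : ℂ) * Xd a b V i j + ((cs s : ℂ) - 1) * Yd a b V i j := by
    intro V; rw [Su_eq hab]; simp [hij]
  have hXt : ∀ V : UG N, Xd a b (V * τ) i j = - Xd a b V i j := by
    intro V
    simp only [Xd, w2_entry hab, hτ, mul_pu]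
    simp
  have hYt : ∀ V : UG N, Yd a b (V * τ) i j = Yd a b V i j := by
    intro V
    simp only [Yd, w2_entry hab, hτ, mul_pu]
    simp; ring
  have e1 : ∫ V, ‖(Su a b s hs V : Mt N) i j‖ ^ 2 ∂μ
      = ∫ V, ((1/2) * ‖(Su a b s hs V : Mt N) i j‖ ^ 2
        + (1/2) * ‖(Su a b s hs (V * τ) : Mt N) i j‖ ^ 2) ∂μ := by
    rw [integral_add (ci μ (by fun_prop)) (ci μ ?_), integral_const_mul, integral_const_mul,
      int_right μ τ (fun V => ‖(Su a b s hs V : Mt N) i j‖ ^ 2)]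
    · ring
    · exact ((hSc.comp (continuous_mul_const τ)).norm.pow 2).const_mul _
  rw [e1, ← off_diag μ hab hij, ← integral_const_mul]
  refine integral_mono (ci μ (by fun_prop)) (ci μ ?_) ?_
  · exact ((hSc.norm.pow 2).const_mul _).add
      (((hSc.comp (continuous_mul_const τ)).norm.pow 2).const_mul _)
  · intro V
    simp only [hS, hXt, hYt]
    set x := (s : ℂ) * Xd a b V i j with hx
    set y := ((cs s : ℂ) - 1) * Yd a b V i j
    have hxn : ‖x‖ ^ 2 = s ^ 2 * ‖Xd a b V i j‖ ^ 2 := by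
      rw [hx, norm_mul, mul_pow]; simp
    rw [← hxn, mul_neg, ← hx]
    have := parallelogram_law_with_norm ℝ y x
    have e2 : -x + y = y - x := by ring
    rw [e2, add_comm x y]
    nlinarith [sq_nonneg ‖y‖]

lemma comm_bound (hab : a ≠ b) (s : ℝ) (hs : s ^ 2 ≤ 1) (A : Mt N) (hA : Aᴴ = -A)
    (hA0 : trace A = 0) :
    2 * N * s ^ 2 * qc μ a b * ‖A‖ ^ 2
      ≤ ∫ V, ‖A * (Su a b s hs V : Mt N) - (Su a b s hs V : Mt N) * A‖ ^ 2 ∂μ := by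
  obtain ⟨Q, h, e, h0, hn⟩ := skew_diag A hA
  have h0 := h0 hA0
  rw [hn, ← int_left μ Q]
  have hSc : ∀ i j, Continuous fun V : UG N => (Su a b s hs V : Mt N) i j := fun i j =>
    (cont_coe.comp (Su_cont s hs)).matrix_elem i j
  have e1 : ∀ V : UG N, ‖A * (Su a b s hs (Q * V) : Mt N) - (Su a b s hs (Q * V) : Mt N) * A‖ ^ 2
      = ∑ i, ∑ j, (h i - h j) ^ 2 * ‖(Su a b s hs V : Mt N) i j‖ ^ 2 := by
    intro V
    have : (Su a b s hs (Q * V) : Mt N) = (Q : Mt N) * (Su a b s hs V : Mt N) * (Q : Mt N)ᴴ := by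
      rw [Su_conj]; rfl
    rw [this, e, conj_mul_conj, conj_mul_conj, ← Matrix.sub_mul, ← Matrix.mul_sub, norm_mul_Us,
      norm_U_mul, fnorm_sq]
    refine Finset.sum_congr rfl fun i _ => Finset.sum_congr rfl fun j _ => ?_
    rw [Matrix.sub_apply, Matrix.diagonal_mul, Matrix.mul_diagonal]
    have : Complex.I * (h i : ℂ) * (Su a b s hs V : Mt N) i j
        - (Su a b s hs V : Mt N) i j * (Complex.I * (h j : ℂ))
        = Complex.I * ((h i - h j : ℝ) : ℂ) * (Su a b s hs V : Mt N) i j := by push_cast; ring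
    rw [this, norm_mul, norm_mul, mul_pow, mul_pow, Complex.norm_real, Real.norm_eq_abs, sq_abs]
    simp
  simp_rw [e1]
  rw [integral_finsetSum _ (fun i _ => ci μ (by fun_prop))]
  have e2 : ∀ i, ∑ j, (h i - h j) ^ 2 * (s ^ 2 * qc μ a b)
      ≤ ∫ V, ∑ j, (h i - h j) ^ 2 * ‖(Su a b s hs V : Mt N) i j‖ ^ 2 ∂μ := by
    intro i
    rw [integral_finsetSum _ (fun j _ => ci μ (by fun_prop))]
    refine Finset.sum_le_sum fun j _ => ?_
    rw [integral_const_mul]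
    by_cases hij : i = j
    · simp [hij]
    · exact mul_le_mul_of_nonneg_left (S_off μ hab s hs hij) (sq_nonneg _)
  refine le_trans (le_of_eq ?_) (Finset.sum_le_sum fun i _ => e2 i)
  simp_rw [← Finset.sum_mul]
  have e3 : ∀ i, ∑ j, (h i - h j) ^ 2 = N * h i ^ 2 + ∑ j, h j ^ 2 := by
    intro i
    have : ∀ j, (h i - h j) ^ 2 = h i ^ 2 + h j ^ 2 - 2 * h i * h j := fun j => by ring
    simp_rw [this]
    rw [Finset.sum_sub_distrib, Finset.sum_add_distrib, ← Finset.mul_sum, h0]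
    simp
  simp_rw [e3]
  rw [Finset.sum_add_distrib, ← Finset.mul_sum]
  simp
  ring

end Moments

/-- A continuous function with a first-order expansion on the unitary group. -/
structure Good (L B l : ℝ) (g : UG N → ℝ) (D : UG N → Mt N → ℝ) : Prop where
  cg : Continuous g
  cD : Continuous (fun p : UG N × Mt N => D p.1 p.2)
  lin : ∀ U, IsLinearMap ℝ (D U)
  B0 : 0 ≤ B
  L0 : 0 ≤ L
  l0 : 0 ≤ l
  lip : ∀ U V : UG N, |g U - g V| ≤ L * ‖(U : Mt N) - (V : Mt N)‖
  Dle : ∀ (U : UG N) (H : Mt N), |D U H| ≤ L * ‖H‖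
  tay : ∀ U V : UG N, |g V - g U - D U ((V : Mt N) - (U : Mt N))| ≤ B * ‖(V : Mt N) - (U : Mt N)‖ ^ 2
  tan : ∀ (U : UG N) (A : Mt N), Aᴴ = -A → trace A = 0 → |D U ((U : Mt N) * A)| ≤ l * ‖A‖

/-- The exponential of a skew-Hermitian matrix as a unitary. -/
noncomputable def eU (A : Mt N) (hA : Aᴴ = -A) : UG N :=
  ⟨NormedSpace.exp A, by
    rw [Matrix.mem_unitaryGroup_iff, star_eq_conjTranspose, ← Matrix.exp_conjTranspose, hA,
      ← Matrix.exp_add_of_commute _ _ (Commute.neg_right (Commute.refl A))]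
    simp⟩

lemma skew_smul {A : Mt N} (hA : Aᴴ = -A) (t : ℝ) : (t • A)ᴴ = -(t • A) := by
  rw [conjTranspose_smul, hA]; simp

lemma eU_small (A : Mt N) {ε : ℝ} (hε : 0 < ε) :
    ∃ δ > 0, ∀ t : ℝ, |t| < δ → ‖NormedSpace.exp (t • A) - 1 - t • A‖ ≤ ε * |t| := by
  have h := hasDerivAt_iff_isLittleO.1 (hasDerivAt_exp_smul_const (𝕂 := ℝ) A (0 : ℝ))
  have h2 := h.def hε
  obtain ⟨δ, hδ, h3⟩ := Metric.eventually_nhds_iff.1 h2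
  refine ⟨δ, hδ, fun t ht => ?_⟩
  have := h3 (y := t) (by simpa using ht)
  simp at this
  exact this

section Step4
set_option linter.unusedSectionVars false
variable [MeasurableSpace (UG N)] [BorelSpace (UG N)]
  (μ : Measure (UG N)) [IsProbabilityMeasure μ] [μ.IsMulLeftInvariant]
variable {a b : Fin N}

lemma int_abs_le {f : UG N → ℝ} {c : ℝ} (h : ∀ V, |f V| ≤ c) : |∫ V, f V ∂μ| ≤ c := by
  have := norm_integral_le_of_norm_le_const (μ := μ) (f := f) (C := c) (.of_forall h)
  simpa using this

lemma int_sq_le {f : UG N → ℝ} (hf : Continuous f) : (∫ V, f V ∂μ) ^ 2 ≤ ∫ V, f V ^ 2 ∂μ := by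
  set m := ∫ V, f V ∂μ with hm
  have h0 : 0 ≤ ∫ V, (f V - m) ^ 2 ∂μ := integral_nonneg fun V => sq_nonneg _
  have h1 : ∫ V, (f V - m) ^ 2 ∂μ = (∫ V, f V ^ 2 ∂μ) - m ^ 2 := by
    have : ∀ V, (f V - m) ^ 2 = f V ^ 2 - 2 * m * f V + m ^ 2 := fun V => by ring
    simp only [this]
    rw [integral_add (ci μ (by fun_prop)) (integrable_const _),
      integral_sub (ci μ (by fun_prop)) (ci μ (by fun_prop)), integral_const_mul, ← hm]
    simp; ring
  linarith

variable (a b) in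
/-- The averaging operator. -/
noncomputable def Pg (s : ℝ) (hs : s ^ 2 ≤ 1) (g : UG N → ℝ) (U : UG N) : ℝ :=
  ∫ V, g (U * Su a b s hs V) ∂μ
variable (a b) in
/-- The derivative of the averaged function. -/
noncomputable def PD (s : ℝ) (hs : s ^ 2 ≤ 1) (D : UG N → Mt N → ℝ) (U : UG N) (H : Mt N) : ℝ :=
  ∫ V, D (U * Su a b s hs V) (H * (Su a b s hs V : Mt N)) ∂μ

instance : LocallyCompactSpace (Mt N) := inferInstanceAs (LocallyCompactSpace (Fin N → Fin N → ℂ))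

lemma cpi {X : Type*} [TopologicalSpace X] [FirstCountableTopology X] [LocallyCompactSpace X]
    {F : X → UG N → ℝ} (hF : Continuous (Function.uncurry F)) :
    Continuous (fun x => ∫ V, F x V ∂μ) := by
  have := continuous_parametric_integral_of_continuous (μ := μ) (f := F) hF (s := Set.univ)
    isCompact_univ
  simpa using this

lemma Pg_cont (s : ℝ) (hs : s ^ 2 ≤ 1) {g : UG N → ℝ} (hg : Continuous g) :
    Continuous (Pg μ a b s hs g) := by
  unfold Pg
  apply cpi μ
  have := Su_cont (a := a) (b := b) s hs
  unfold Function.uncurry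
  fun_prop

lemma Dcomp {X : Type*} [TopologicalSpace X] {D : UG N → Mt N → ℝ}
    (hD : Continuous (fun p : UG N × Mt N => D p.1 p.2)) {u : X → UG N} {h : X → Mt N}
    (hu : Continuous u) (hh : Continuous h) : Continuous (fun x => D (u x) (h x)) :=
  hD.comp (hu.prodMk hh)

lemma Sc_cont (s : ℝ) (hs : s ^ 2 ≤ 1) : Continuous fun V => (Su a b s hs V : Mt N) :=
  cont_coe.comp (Su_cont s hs)

lemma PD_cont (s : ℝ) (hs : s ^ 2 ≤ 1) {D : UG N → Mt N → ℝ}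
    (hD : Continuous (fun p : UG N × Mt N => D p.1 p.2)) :
    Continuous (fun p : UG N × Mt N => PD μ a b s hs D p.1 p.2) := by
  unfold PD
  apply cpi μ (X := UG N × Mt N) (F := fun p V => D (p.1 * Su a b s hs V) (p.2 * (Su a b s hs V : Mt N)))
  have h1 := Su_cont (a := a) (b := b) s hs
  have h2 := Sc_cont (a := a) (b := b) s hs
  unfold Function.uncurry
  apply Dcomp hD
  · fun_prop
  · exact (continuous_snd.comp continuous_fst).mul (h2.comp continuous_snd)

lemma inv_pt {L B l : ℝ} {g : UG N → ℝ} {D : UG N → Mt N → ℝ} (hG : Good L B l g D)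
    (U e S : UG N) (A E : Mt N) (t ε C : ℝ)
    (hC : C = 4 * B * (‖A‖ + 1) ^ 2 + 2 * L * ‖A‖ * (‖A‖ + 1) + 2 * L)
    (ht0 : 0 < t) (hε1 : ε ≤ 1) (htε : t ≤ ε) (hE : ‖E‖ ≤ ε * t)
    (hed : (e : Mt N) = 1 + t • A + E)
    (hei : ‖((e⁻¹ : UG N) : Mt N) - 1‖ ≤ t * (‖A‖ + 1)) :
    |g (U * (e * S * e⁻¹)) - g (U * S)
        - t * D (U * S) ((U : Mt N) * (A * (S : Mt N) - (S : Mt N) * A))| ≤ t * (ε * C) := by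
  set K : Mt N := A * (S : Mt N) - (S : Mt N) * A with hK
  set F : Mt N := E * (S : Mt N) - (S : Mt N) * E with hF
  have hKn : ‖K‖ ≤ 2 * ‖A‖ := by
    refine (norm_sub_le _ _).trans ?_
    rw [norm_mul_U, norm_U_mul]; linarith
  have hFn : ‖F‖ ≤ 2 * (ε * t) := by
    refine (norm_sub_le _ _).trans ?_
    rw [norm_mul_U, norm_U_mul]; linarith
  have hd : ((e * S * e⁻¹ : UG N) : Mt N) - (S : Mt N) = (t • K + F) * ((e⁻¹ : UG N) : Mt N) := by
    have h1 : ((e * S * e⁻¹ : UG N) : Mt N) = (e : Mt N) * (S : Mt N) * ((e⁻¹ : UG N) : Mt N) := rfl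
    have h2 : (S : Mt N) = (S : Mt N) * (e : Mt N) * ((e⁻¹ : UG N) : Mt N) := by
      rw [Matrix.mul_assoc, coe_inv_U, U_mul_star, Matrix.mul_one]
    have h3 : t • K + F = (e : Mt N) * (S : Mt N) - (S : Mt N) * (e : Mt N) := by
      rw [hed, hK, hF]
      simp only [Matrix.add_mul, Matrix.mul_add, smul_sub, Matrix.smul_mul, Matrix.mul_smul,
        Matrix.one_mul, Matrix.mul_one]
      abel
    rw [h3, Matrix.sub_mul, ← h2, h1]
  have hdn : ‖((e * S * e⁻¹ : UG N) : Mt N) - (S : Mt N)‖ ≤ 2 * t * (‖A‖ + 1) := by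
    rw [hd, norm_mul_U]
    refine (norm_add_le _ _).trans ?_
    rw [norm_smul, Real.norm_of_nonneg ht0.le]
    nlinarith
  have hr : ‖((e * S * e⁻¹ : UG N) : Mt N) - (S : Mt N) - t • K‖
      ≤ t * (2 * ‖A‖) * (t * (‖A‖ + 1)) + 2 * (ε * t) := by
    have : ((e * S * e⁻¹ : UG N) : Mt N) - (S : Mt N) - t • K
        = (t • K) * (((e⁻¹ : UG N) : Mt N) - 1) + F * ((e⁻¹ : UG N) : Mt N) := by
      rw [hd, Matrix.add_mul, Matrix.mul_sub, Matrix.mul_one]; abel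
    rw [this]
    refine (norm_add_le _ _).trans (add_le_add ((norm_mul_le _ _).trans ?_) ?_)
    · gcongr
      rw [norm_smul, Real.norm_of_nonneg ht0.le]
      gcongr
    · rw [norm_mul_U]; exact hFn
  have h1 := hG.tay (U * S) (U * (e * S * e⁻¹))
  have hm : ((U * (e * S * e⁻¹) : UG N) : Mt N) - ((U * S : UG N) : Mt N)
      = (U : Mt N) * (((e * S * e⁻¹ : UG N) : Mt N) - (S : Mt N)) := by
    rw [Matrix.mul_sub]; rfl
  rw [hm, norm_U_mul] at h1
  have h2 := hG.Dle (U * S) ((U : Mt N) * (((e * S * e⁻¹ : UG N) : Mt N) - (S : Mt N) - t • K))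
  rw [norm_U_mul, Matrix.mul_sub, (hG.lin _).map_sub, Matrix.mul_smul, (hG.lin _).map_smul,
    smul_eq_mul] at h2
  have h3 : B * ‖((e * S * e⁻¹ : UG N) : Mt N) - (S : Mt N)‖ ^ 2 ≤ B * (2 * t * (‖A‖ + 1)) ^ 2 := by
    have := hG.B0
    gcongr
  have h4 := mul_le_mul_of_nonneg_left hr hG.L0
  have h5 : B * (2 * t * (‖A‖ + 1)) ^ 2 ≤ t * (ε * (4 * B * (‖A‖ + 1) ^ 2)) := by
    have := hG.B0
    have h6 : t * t ≤ t * ε := by gcongr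
    have h7 : 0 ≤ 4 * B * (‖A‖ + 1) ^ 2 := by positivity
    have h7b := mul_le_mul_of_nonneg_right h6 h7
    calc _ = t * t * (4 * B * (‖A‖ + 1) ^ 2) := by ring
      _ ≤ _ := h7b
      _ = _ := by ring
  have h8 : L * (t * (2 * ‖A‖) * (t * (‖A‖ + 1)) + 2 * (ε * t))
      ≤ t * (ε * (2 * L * ‖A‖ * (‖A‖ + 1) + 2 * L)) := by
    have := hG.L0
    have h6 : t * t ≤ t * ε := by gcongr
    have h7 : 0 ≤ 2 * L * ‖A‖ * (‖A‖ + 1) := by positivity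
    have h7b := mul_le_mul_of_nonneg_right h6 h7
    calc _ = t * t * (2 * L * ‖A‖ * (‖A‖ + 1)) + t * (ε * (2 * L)) := by ring
      _ ≤ t * ε * (2 * L * ‖A‖ * (‖A‖ + 1)) + t * (ε * (2 * L)) := by gcongr
      _ = _ := by ring
  have h9 := abs_add_le (g (U * (e * S * e⁻¹)) - g (U * S) -
    D (U * S) ((U : Mt N) * (((e * S * e⁻¹ : UG N) : Mt N) - (S : Mt N))))
    (D (U * S) ((U : Mt N) * (((e * S * e⁻¹ : UG N) : Mt N) - (S : Mt N))) - t * D (U * S) ((U : Mt N) * K))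
  rw [show ∀ x y z w : ℝ, x - y - z + (z - w) = x - y - w from fun x y z w => by ring] at h9
  refine h9.trans ((add_le_add (h1.trans (h3.trans h5)) (h2.trans (h4.trans h8))).trans ?_)
  rw [hC]
  apply le_of_eq
  ring

set_option maxHeartbeats 1000000 in
lemma inv_lemma {L B l : ℝ} {g : UG N → ℝ} {D : UG N → Mt N → ℝ} (hG : Good L B l g D)
    (s : ℝ) (hs : s ^ 2 ≤ 1) (U : UG N) (A : Mt N) (hA : Aᴴ = -A) :
    ∫ V, D (U * Su a b s hs V)
      ((U : Mt N) * (A * (Su a b s hs V : Mt N) - (Su a b s hs V : Mt N) * A)) ∂μ = 0 := by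
  set I := ∫ V, D (U * Su a b s hs V)
      ((U : Mt N) * (A * (Su a b s hs V : Mt N) - (Su a b s hs V : Mt N) * A)) ∂μ with hI
  have hSc := Sc_cont (a := a) (b := b) s hs
  have hSu := Su_cont (a := a) (b := b) s hs
  set C := 4 * B * (‖A‖ + 1) ^ 2 + 2 * L * ‖A‖ * (‖A‖ + 1) + 2 * L with hC
  have key : ∀ ε : ℝ, 0 < ε → ε ≤ 1 → |I| ≤ ε * C := by
    intro ε hε hε1
    obtain ⟨δ, hδ, hE⟩ := eU_small A hε
    set t := min (δ / 2) ε with htdef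
    have ht0 : 0 < t := by positivity
    have htδ : |t| < δ := by
      rw [abs_of_pos ht0]; exact lt_of_le_of_lt (min_le_left _ _) (by linarith)
    have htε : t ≤ ε := min_le_right _ _
    have hE := hE t htδ
    rw [abs_of_pos ht0] at hE
    set e : UG N := eU (t • A) (skew_smul hA t) with he
    have hee : (e : Mt N) = NormedSpace.exp (t • A) := rfl
    rw [← hee] at hE
    set E : Mt N := (e : Mt N) - 1 - t • A with hEd
    have hed : (e : Mt N) = 1 + t • A + E := by rw [hEd]; abel
    have htA : ‖t • A‖ = t * ‖A‖ := by rw [norm_smul, Real.norm_of_nonneg ht0.le]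
    have he1 : ‖(e : Mt N) - 1‖ ≤ t * (‖A‖ + 1) := by
      have : (e : Mt N) - 1 = t • A + E := by rw [hEd]; abel
      rw [this]
      refine (norm_add_le _ _).trans ?_
      rw [htA]; nlinarith
    have hei : ‖((e⁻¹ : UG N) : Mt N) - 1‖ ≤ t * (‖A‖ + 1) := by
      have : ((e⁻¹ : UG N) : Mt N) - 1 = -(((e⁻¹ : UG N) : Mt N) * ((e : Mt N) - 1)) := by
        rw [Matrix.mul_sub, coe_inv_U, star_U_mul]; simp
      rw [this, norm_neg, norm_U_mul]; exact he1
    have hz : ∫ V, g (U * (e * Su a b s hs V * e⁻¹)) ∂μ = ∫ V, g (U * Su a b s hs V) ∂μ := by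
      rw [← int_left μ e (fun V => g (U * Su a b s hs V))]
      simp only [Su_conj]
    have hcg := hG.cg
    have hb : ∀ V, |g (U * (e * Su a b s hs V * e⁻¹)) - g (U * Su a b s hs V)
        - t * D (U * Su a b s hs V)
          ((U : Mt N) * (A * (Su a b s hs V : Mt N) - (Su a b s hs V : Mt N) * A))| ≤ t * (ε * C) := by
      intro V
      exact inv_pt hG U e (Su a b s hs V) A E t ε C hC ht0 hε1 htε hE hed hei
    have h_intg := int_abs_le μ hb
    have c1 : Continuous fun V => g (U * (e * Su a b s hs V * e⁻¹)) :=
      hcg.comp (continuous_const.mul ((continuous_const.mul hSu).mul continuous_const))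
    have c2 : Continuous fun V => g (U * Su a b s hs V) :=
      hcg.comp (continuous_const.mul hSu)
    have c3 : Continuous fun V => D (U * Su a b s hs V)
          ((U : Mt N) * (A * (Su a b s hs V : Mt N) - (Su a b s hs V : Mt N) * A)) := by
      apply Dcomp hG.cD
      · exact continuous_const.mul hSu
      · exact continuous_const.mul ((continuous_const.mul hSc).sub (hSc.mul continuous_const))
    rw [integral_sub (ci μ (c1.fun_sub c2)) (ci μ (continuous_const.fun_mul c3)),
      integral_sub (ci μ c1) (ci μ c2), hz, integral_const_mul, ← hI, sub_self, zero_sub, abs_neg,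
      abs_mul, abs_of_pos ht0] at h_intg
    exact le_of_mul_le_mul_left h_intg ht0
  have hC0 : 0 ≤ C := by
    have := hG.B0
    have := hG.L0
    positivity
  have : |I| ≤ 0 := by
    apply le_of_forall_pos_le_add
    intro η hη
    have h1 := key (min 1 (η / (C + 1))) (by positivity) (min_le_left _ _)
    have h2 : min 1 (η / (C + 1)) * C ≤ η / (C + 1) * C := by
      gcongr; exact min_le_right _ _
    have h3 : η / (C + 1) * C ≤ η := by
      rw [div_mul_eq_mul_div, div_le_iff₀ (by linarith)]; nlinarith
    linarith
  exact abs_nonpos_iff.1 this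

lemma sym_norm (A : Mt N) (S : UG N) :
    ‖(1 / 2 : ℝ) • ((S : Mt N)ᴴ * A * (S : Mt N) + A)‖ ^ 2
      = ‖A‖ ^ 2 - ‖A * (S : Mt N) - (S : Mt N) * A‖ ^ 2 / 4 := by
  have h1 : ‖(S : Mt N)ᴴ * A * (S : Mt N) + A‖ = ‖A * (S : Mt N) + (S : Mt N) * A‖ := by
    rw [← norm_U_mul S, Matrix.mul_add, Matrix.mul_assoc, ← Matrix.mul_assoc (S : Mt N), U_mul_star,
      Matrix.one_mul]
  rw [norm_smul, h1]
  have h2 : ‖A * (S : Mt N)‖ ^ 2 = ‖A‖ ^ 2 := by rw [norm_mul_U]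
  have h3 : ‖(S : Mt N) * A‖ ^ 2 = ‖A‖ ^ 2 := by rw [norm_U_mul]
  rw [← ip_self] at h2 h3
  have e1 := ip_self (A * (S : Mt N) + (S : Mt N) * A)
  have e2 := ip_self (A * (S : Mt N) - (S : Mt N) * A)
  rw [ip_add_left, ip_add_right, ip_add_right] at e1
  rw [ip_sub_left, ip_sub_right, ip_sub_right] at e2
  rw [mul_pow, ← e1, ← e2, h2, h3]
  norm_num
  ring

lemma good_step {L B l : ℝ} {g : UG N → ℝ} {D : UG N → Mt N → ℝ} (hG : Good L B l g D)
    (hab : a ≠ b) (s : ℝ) (hs : s ^ 2 ≤ 1) (θ : ℝ) (hθ0 : 0 ≤ θ)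
    (hθ : θ = 1 - N * s ^ 2 * qc μ a b / 2) :
    Good L B (l * √θ) (Pg μ a b s hs g) (PD μ a b s hs D) := by
  have hSc := Sc_cont (a := a) (b := b) s hs
  have hSu := Su_cont (a := a) (b := b) s hs
  have cg : ∀ U : UG N, Continuous fun V => g (U * Su a b s hs V) := fun U =>
    hG.cg.comp (continuous_const.mul hSu)
  have cD : ∀ (U : UG N) (H : Mt N),
      Continuous fun V => D (U * Su a b s hs V) (H * (Su a b s hs V : Mt N)) := fun U H =>
    Dcomp hG.cD (continuous_const.mul hSu) (continuous_const.mul hSc)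
  have hcoe : ∀ U V : UG N, ((U * V : UG N) : Mt N) = (U : Mt N) * (V : Mt N) := fun U V => rfl
  refine ⟨Pg_cont μ s hs hG.cg, PD_cont μ s hs hG.cD, ?_, hG.B0, hG.L0,
    mul_nonneg hG.l0 (Real.sqrt_nonneg _), ?_, ?_, ?_, ?_⟩
  · intro U
    constructor
    · intro x y
      unfold PD
      rw [← integral_add (ci μ (cD U x)) (ci μ (cD U y))]
      refine integral_congr_ae (.of_forall fun V => ?_)
      simp only [Matrix.add_mul, (hG.lin _).map_add]
    · intro c x
      unfold PD
      rw [smul_eq_mul, ← integral_const_mul]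
      refine integral_congr_ae (.of_forall fun V => ?_)
      simp only [Matrix.smul_mul, (hG.lin _).map_smul, smul_eq_mul]
  · intro U W
    unfold Pg
    rw [← integral_sub (ci μ (cg U)) (ci μ (cg W))]
    refine int_abs_le μ fun V => ?_
    refine (hG.lip _ _).trans (le_of_eq ?_)
    rw [hcoe, hcoe, ← Matrix.sub_mul, norm_mul_U]
  · intro U H
    refine int_abs_le μ fun V => ?_
    refine (hG.Dle _ _).trans (le_of_eq ?_)
    rw [norm_mul_U]
  · intro U W
    unfold Pg PD
    rw [← integral_sub (ci μ (cg W)) (ci μ (cg U)),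
      ← integral_sub (ci μ ((cg W).fun_sub (cg U))) (ci μ (cD U _))]
    refine int_abs_le μ fun V => ?_
    have := hG.tay (U * Su a b s hs V) (W * Su a b s hs V)
    rw [hcoe, hcoe, ← Matrix.sub_mul, norm_mul_U] at this
    exact this
  · intro U A hA hA0
    set C : UG N → Mt N := fun V =>
      (1 / 2 : ℝ) • ((Su a b s hs V : Mt N)ᴴ * A * (Su a b s hs V : Mt N) + A) with hC
    have hCc : Continuous C := by
      have h1 : Continuous fun V => (Su a b s hs V : Mt N)ᴴ * A * (Su a b s hs V : Mt N) + A :=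
        ((hSc.matrix_conjTranspose.mul continuous_const).mul hSc).add continuous_const
      exact h1.const_smul (1 / 2 : ℝ)
    have c4 : Continuous fun V => D (U * Su a b s hs V)
          ((U : Mt N) * (A * (Su a b s hs V : Mt N) - (Su a b s hs V : Mt N) * A)) :=
      Dcomp hG.cD (continuous_const.mul hSu)
        (continuous_const.mul ((continuous_const.mul hSc).sub (hSc.mul continuous_const)))
    have c5 : Continuous fun V => D (U * Su a b s hs V) (((U * Su a b s hs V : UG N) : Mt N) * C V) :=
      Dcomp hG.cD (continuous_const.mul hSu) ((cont_coe.comp (continuous_const.mul hSu)).mul hCc)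
    have e1 : PD μ a b s hs D U ((U : Mt N) * A)
        = ∫ V, D (U * Su a b s hs V) (((U * Su a b s hs V : UG N) : Mt N) * C V) ∂μ := by
      have h0 := inv_lemma μ (a := a) (b := b) hG s hs U A hA
      have h1 : ∀ V, D (U * Su a b s hs V) (((U : Mt N) * A) * (Su a b s hs V : Mt N))
          = D (U * Su a b s hs V) (((U * Su a b s hs V : UG N) : Mt N) * C V)
          + (1 / 2 : ℝ) * D (U * Su a b s hs V)
          ((U : Mt N) * (A * (Su a b s hs V : Mt N) - (Su a b s hs V : Mt N) * A)) := by
        intro V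
        rw [← smul_eq_mul (1 / 2 : ℝ), ← (hG.lin _).map_smul, ← (hG.lin _).map_add]
        congr 1
        rw [hcoe, hC]
        simp only [Matrix.mul_smul, ← smul_add]
        rw [Matrix.mul_assoc (U : Mt N) (Su a b s hs V : Mt N), ← Matrix.mul_add, Matrix.mul_add (Su a b s hs V : Mt N),
          ← Matrix.mul_assoc (Su a b s hs V : Mt N), ← Matrix.mul_assoc (Su a b s hs V : Mt N), U_mul_star,
          Matrix.one_mul]
        rw [show A * (Su a b s hs V : Mt N) + (Su a b s hs V : Mt N) * A +
          (A * (Su a b s hs V : Mt N) - (Su a b s hs V : Mt N) * A)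
          = (2 : ℝ) • (A * (Su a b s hs V : Mt N)) by rw [two_smul]; abel, Matrix.mul_smul, smul_smul]
        norm_num [Matrix.mul_assoc]
      unfold PD
      simp only [h1]
      rw [integral_add (ci μ c5) (ci μ (continuous_const.fun_mul c4)), integral_const_mul, h0]
      simp
    have hsk : ∀ V, (C V)ᴴ = - C V := by
      intro V
      rw [hC]
      simp only [conjTranspose_smul, conjTranspose_add, conjTranspose_mul, conjTranspose_conjTranspose,
        hA, star_trivial, Matrix.mul_neg, Matrix.neg_mul, Matrix.mul_assoc]
      rw [← smul_neg, neg_add]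
    have htr : ∀ V, trace (C V) = 0 := by
      intro V
      rw [hC]
      simp only [trace_smul, trace_add]
      rw [Matrix.trace_mul_comm, ← Matrix.mul_assoc, U_mul_star, Matrix.one_mul, hA0]
      simp
    have hn : ∀ V, ‖C V‖ ^ 2 = ‖A‖ ^ 2 - ‖A * (Su a b s hs V : Mt N) - (Su a b s hs V : Mt N) * A‖ ^ 2 / 4 :=
      fun V => sym_norm A _
    have c6 : Continuous fun V => ‖A * (Su a b s hs V : Mt N) - (Su a b s hs V : Mt N) * A‖ ^ 2 :=
      (cont_norm.comp ((continuous_const.mul hSc).sub (hSc.mul continuous_const))).pow 2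
    have e2 : ∫ V, ‖C V‖ ^ 2 ∂μ ≤ θ * ‖A‖ ^ 2 := by
      simp only [hn]
      rw [integral_sub (integrable_const _) ((ci μ c6).div_const 4), integral_div]
      have := comm_bound μ hab s hs A hA hA0
      simp
      rw [hθ]
      linarith
    rw [e1]
    refine abs_le_of_sq_le_sq ?_ (mul_nonneg (mul_nonneg hG.l0 (Real.sqrt_nonneg _)) (norm_nonneg _))
    refine (int_sq_le μ c5).trans ?_
    calc _ ≤ ∫ V, l ^ 2 * ‖C V‖ ^ 2 ∂μ := by
          refine integral_mono (ci μ (c5.pow 2)) (ci μ (continuous_const.mul ((cont_norm.comp hCc).pow 2))) fun V => ?_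
          have := hG.tan (U * Su a b s hs V) (C V) (hsk V) (htr V)
          simp only
          rw [← mul_pow, ← sq_abs]
          exact pow_le_pow_left₀ (abs_nonneg _) this 2
      _ = l ^ 2 * ∫ V, ‖C V‖ ^ 2 ∂μ := integral_const_mul _ _
      _ ≤ l ^ 2 * (θ * ‖A‖ ^ 2) := by gcongr
      _ = _ := by rw [mul_pow, mul_pow, Real.sq_sqrt hθ0]; ring

end Step4

lemma riesz {c : Mt N → ℝ} (hc : IsLinearMap ℝ c) : ∃ K : Mt N, ∀ M, c M = ip K M := by
  set f : Mt N →ₗ[ℝ] ℝ := hc.mk' c with hf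
  refine ⟨Matrix.of fun i j => (c (Matrix.single i j 1) : ℂ) + Complex.I * (c (Matrix.single i j Complex.I) : ℂ),
    fun M => ?_⟩
  have h1 : ∀ i j, Matrix.single i j (M i j) = (M i j).re • Matrix.single i j (1 : ℂ)
      + (M i j).im • (Matrix.single i j Complex.I : Mt N) := by
    intro i j
    rw [Matrix.smul_single, Matrix.smul_single, ← Matrix.single_add]
    congr 1
    apply Complex.ext <;> simp
  have h2 : c M = f (∑ i, ∑ j, Matrix.single i j (M i j)) := by
    rw [← Matrix.matrix_eq_sum_single]; rfl
  rw [h2, ip_eq_sum]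
  simp only [map_sum, h1, map_add, map_smul, smul_eq_mul]
  refine Finset.sum_congr rfl fun i _ => Finset.sum_congr rfl fun j _ => ?_
  simp [hf]
  ring

lemma proj (hN : N ≠ 0) (K : Mt N) : ∃ K' : Mt N, K'ᴴ = -K' ∧ trace K' = 0 ∧
    ∀ X : Mt N, Xᴴ = -X → trace X = 0 → ip K X = ip K' X := by
  set K1 : Mt N := (1 / 2 : ℝ) • (K - Kᴴ) with hK1
  have s1 : K1ᴴ = -K1 := by
    rw [hK1, conjTranspose_smul, conjTranspose_sub, conjTranspose_conjTranspose, star_trivial,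
      ← smul_neg, neg_sub]
  have t1 : star (trace K1) = - trace K1 := by
    rw [← Matrix.trace_conjTranspose, s1, trace_neg]
  refine ⟨K1 - (trace K1 / N) • (1 : Mt N), ?_, ?_, ?_⟩
  · rw [conjTranspose_sub, s1, conjTranspose_smul, conjTranspose_one, star_div₀, t1]
    simp [neg_div]
    abel
  · rw [trace_sub, trace_smul _ (1 : Mt N), trace_one]
    have : (N : ℂ) ≠ 0 := by exact_mod_cast hN
    simp
    field_simp
    ring
  · intro X hX hX0
    have h1 : ip Kᴴ X = - ip K X := by
      rw [ip, ip, conjTranspose_conjTranspose]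
      have : star (trace (Kᴴ * X)) = - trace (K * X) := by
        rw [← Matrix.trace_conjTranspose, conjTranspose_mul, conjTranspose_conjTranspose, hX,
          Matrix.neg_mul, trace_neg, Matrix.trace_mul_comm]
      have h3 := congrArg Complex.re this
      simp at h3
      rw [h3]; simp
    have h2 : ip ((trace K1 / N) • (1 : Mt N)) X = 0 := by
      rw [ip, conjTranspose_smul, conjTranspose_one, Matrix.smul_mul, Matrix.one_mul, trace_smul, hX0]
      simp
    rw [ip_sub_left, h2, hK1, ip_comm (_ • _) X, ip_smul_right, ip_comm X, ip_sub_left, h1]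
    ring

section Step5
set_option linter.unusedSectionVars false
variable [MeasurableSpace (UG N)] [BorelSpace (UG N)]
  (μ : Measure (UG N)) [IsProbabilityMeasure μ] [μ.IsMulLeftInvariant]
variable {a b : Fin N}

lemma c_var {L B l : ℝ} {g : UG N → ℝ} {D : UG N → Mt N → ℝ} (hG : Good L B l g D)
    (hab : a ≠ b) (U : UG N) :
    ∫ V, (D U ((U : Mt N) * Xd a b V)) ^ 2 ∂μ ≤ qc μ a b * l ^ 2 := by
  have hc : IsLinearMap ℝ (fun H : Mt N => D U ((U : Mt N) * H)) := by
    constructor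
    · intro x y; simp only [Matrix.mul_add, (hG.lin U).map_add]
    · intro r x; simp only [Matrix.mul_smul, (hG.lin U).map_smul]
  obtain ⟨K, hK⟩ := riesz hc
  obtain ⟨K', s, t, h⟩ := proj (by rintro rfl; exact a.elim0) K
  have h1 : ∀ V, D U ((U : Mt N) * Xd a b V) = ip K' (Xd a b V) := fun V => by
    rw [← h _ (Xd_skew V) (Xd_trace hab V), ← hK]
  simp only [h1]
  rw [iso μ hab K' s t]
  have h2 : ‖K'‖ ^ 2 ≤ l * ‖K'‖ := by
    rw [← ip_self, ← h _ s t, ← hK]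
    exact (le_abs_self _).trans (hG.tan U K' s t)
  have h3 : ‖K'‖ ≤ l := by
    by_contra hlt
    push Not at hlt
    have := hG.l0
    nlinarith
  have := (qc_pos μ hab).le
  gcongr

lemma loc {L B l : ℝ} {g : UG N → ℝ} {D : UG N → Mt N → ℝ} (hG : Good L B l g D)
    (hab : a ≠ b) (s : ℝ) (hs : s ^ 2 ≤ 1) (hs0 : 0 ≤ s) (U V : UG N) :
    |g (U * Su a b s hs V) - g U - s * D U ((U : Mt N) * Xd a b V)| ≤ (16 * B + 2 * L) * s ^ 2 := by
  have h1 := hG.tay U (U * Su a b s hs V)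
  have hm : ((U * Su a b s hs V : UG N) : Mt N) - (U : Mt N)
      = (U : Mt N) * ((Su a b s hs V : Mt N) - 1) := by
    rw [Matrix.mul_sub, Matrix.mul_one]; rfl
  rw [hm, norm_U_mul] at h1
  have h2 := hG.Dle U ((U : Mt N) * ((Su a b s hs V : Mt N) - 1 - s • Xd a b V))
  rw [norm_U_mul, Matrix.mul_sub, (hG.lin _).map_sub, Matrix.mul_smul, (hG.lin _).map_smul,
    smul_eq_mul] at h2
  have h3 : ‖(Su a b s hs V : Mt N) - 1 - s • Xd a b V‖ ≤ 2 * s ^ 2 := Su_rem hab s hs V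
  have h4 : B * ‖(Su a b s hs V : Mt N) - 1‖ ^ 2 ≤ B * (4 * s) ^ 2 := by
    have := hG.B0
    have := Su_sub_one hab s hs hs0 V
    gcongr
  have h5 := mul_le_mul_of_nonneg_left h3 hG.L0
  have h9 := abs_add_le (g (U * Su a b s hs V) - g U - D U ((U : Mt N) * ((Su a b s hs V : Mt N) - 1)))
    (D U ((U : Mt N) * ((Su a b s hs V : Mt N) - 1)) - s * D U ((U : Mt N) * Xd a b V))
  rw [show ∀ x y z w : ℝ, x - y - z + (z - w) = x - y - w from fun x y z w => by ring] at h9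
  refine h9.trans ((add_le_add (h1.trans h4) (h2.trans h5)).trans (le_of_eq (by ring)))

lemma loc_var {L B l : ℝ} {g : UG N → ℝ} {D : UG N → Mt N → ℝ} (hG : Good L B l g D)
    (hab : a ≠ b) (s : ℝ) (hs : s ^ 2 ≤ 1) (hs0 : 0 ≤ s) (U : UG N) :
    ∫ V, (g (U * Su a b s hs V) - g U) ^ 2 ∂μ
      ≤ 3 / 2 * s ^ 2 * (qc μ a b * l ^ 2) + 3 * (16 * B + 2 * L) ^ 2 * s ^ 4 := by
  have hSu := Su_cont (a := a) (b := b) s hs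
  have hcg := hG.cg
  have c1 : Continuous fun V => g (U * Su a b s hs V) := hG.cg.comp (continuous_const.mul hSu)
  have c2 : Continuous fun V => D U ((U : Mt N) * Xd a b V) :=
    Dcomp hG.cD continuous_const (continuous_const.mul Xd_cont)
  calc _ ≤ ∫ V, (3 / 2 * s ^ 2 * (D U ((U : Mt N) * Xd a b V)) ^ 2 + 3 * (16 * B + 2 * L) ^ 2 * s ^ 4) ∂μ := by
        refine integral_mono (ci μ (by fun_prop)) (ci μ ((continuous_const.mul (c2.pow 2)).add continuous_const)) fun V => ?_
        simp only
        have h := loc hG hab s hs hs0 U V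
        have h2 := pow_le_pow_left₀ (abs_nonneg _) h 2
        rw [sq_abs] at h2
        set x := g (U * Su a b s hs V) - g U
        set y := s * D U ((U : Mt N) * Xd a b V) with hy
        have h3 : 3 / 2 * s ^ 2 * (D U ((U : Mt N) * Xd a b V)) ^ 2 = 3 / 2 * y ^ 2 := by rw [hy]; ring
        rw [h3]
        nlinarith [sq_nonneg (y - 2 * (x - y))]
    _ = 3 / 2 * s ^ 2 * (∫ V, (D U ((U : Mt N) * Xd a b V)) ^ 2 ∂μ) + 3 * (16 * B + 2 * L) ^ 2 * s ^ 4 := by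
        rw [integral_add (ci μ (continuous_const.fun_mul (c2.fun_pow 2))) (integrable_const _), integral_const_mul]; simp
    _ ≤ _ := by
        have := c_var μ hG hab U
        gcongr

lemma loc_exp {L B l : ℝ} {g : UG N → ℝ} {D : UG N → Mt N → ℝ} (hG : Good L B l g D)
    (hab : a ≠ b) (s : ℝ) (hs : s ^ 2 ≤ 1) (hs0 : 0 ≤ s) (r : ℝ) (hr : |r| * (8 * L * s) ≤ 1) (U : UG N) :
    ∫ V, Real.exp (r * g (U * Su a b s hs V)) ∂μ
      ≤ Real.exp (r ^ 2 * (3 / 2 * s ^ 2 * (qc μ a b * l ^ 2) + 3 * (16 * B + 2 * L) ^ 2 * s ^ 4))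
        * Real.exp (r * Pg μ a b s hs g U) := by
  have hSu := Su_cont (a := a) (b := b) s hs
  have hcg := hG.cg
  have c1 : Continuous fun V => g (U * Su a b s hs V) := hG.cg.comp (continuous_const.mul hSu)
  set m := Pg μ a b s hs g U with hm
  have hm' : ∫ V, g (U * Su a b s hs V) ∂μ = m := rfl
  have b1 : ∀ V, |g (U * Su a b s hs V) - g U| ≤ L * (4 * s) := by
    intro V
    refine (hG.lip _ _).trans ?_
    have hm : ((U * Su a b s hs V : UG N) : Mt N) - (U : Mt N)
        = (U : Mt N) * ((Su a b s hs V : Mt N) - 1) := by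
      rw [Matrix.mul_sub, Matrix.mul_one]; rfl
    rw [hm, norm_U_mul]
    exact mul_le_mul_of_nonneg_left (Su_sub_one hab s hs hs0 V) hG.L0
  have i1 : ∫ V, (g (U * Su a b s hs V) - g U) ∂μ = m - g U := by
    rw [integral_sub (ci μ c1) (integrable_const _), hm']; simp
  have b2 : |m - g U| ≤ L * (4 * s) := by
    rw [← i1]; exact int_abs_le μ b1
  have b3 : ∀ V, |r * (g (U * Su a b s hs V) - m)| ≤ 1 := by
    intro V
    rw [abs_mul]
    refine le_trans (mul_le_mul_of_nonneg_left ?_ (abs_nonneg r)) hr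
    have h3 := abs_sub (g (U * Su a b s hs V) - g U) (m - g U)
    rw [sub_sub_sub_cancel_right] at h3
    linarith [b1 V]
  set v := ∫ V, (g (U * Su a b s hs V) - g U) ^ 2 ∂μ with hv
  have hvar : ∫ V, (g (U * Su a b s hs V) - m) ^ 2 ∂μ ≤ v := by
    have : ∀ V, (g (U * Su a b s hs V) - m) ^ 2 = (g (U * Su a b s hs V) - g U) ^ 2
        - 2 * (m - g U) * (g (U * Su a b s hs V) - g U) + (m - g U) ^ 2 := fun V => by ring
    simp only [this]
    rw [integral_add (ci μ (by fun_prop)) (integrable_const _),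
      integral_sub (ci μ (by fun_prop)) (ci μ (by fun_prop)), integral_const_mul, i1, ← hv]
    simp
    nlinarith [sq_nonneg (m - g U)]
  have key : ∫ V, Real.exp (r * (g (U * Su a b s hs V) - m)) ∂μ ≤ 1 + r ^ 2 * v := by
    calc _ ≤ ∫ V, (1 + r * (g (U * Su a b s hs V) - m) + r ^ 2 * (g (U * Su a b s hs V) - m) ^ 2) ∂μ := by
          refine integral_mono (ci μ (by fun_prop)) (ci μ (by fun_prop)) fun V => ?_
          simp only
          have := (abs_le.1 (Real.abs_exp_sub_one_sub_id_le (b3 V))).2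
          rw [mul_pow] at this
          linarith
      _ = 1 + r ^ 2 * ∫ V, (g (U * Su a b s hs V) - m) ^ 2 ∂μ := by
          rw [integral_add (ci μ (by fun_prop)) (ci μ (by fun_prop)),
            integral_add (integrable_const _) (ci μ (by fun_prop)), integral_const_mul,
            integral_const_mul, integral_sub (ci μ c1) (integrable_const _), hm']
          simp
      _ ≤ _ := by gcongr
  have e1 : ∀ V, Real.exp (r * g (U * Su a b s hs V))
      = Real.exp (r * (g (U * Su a b s hs V) - m)) * Real.exp (r * m) := by
    intro V; rw [← Real.exp_add]; congr 1; ring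
  simp only [e1]
  rw [integral_mul_const]
  gcongr
  have h4 := loc_var μ hG hab s hs hs0 U
  refine key.trans ?_
  have h5 := Real.add_one_le_exp (r ^ 2 * v)
  refine (by linarith : 1 + r ^ 2 * v ≤ Real.exp (r ^ 2 * v)).trans ?_
  gcongr

lemma int_step {g : UG N → ℝ} (hg : Continuous g) (s : ℝ) (hs : s ^ 2 ≤ 1) :
    ∫ U, ∫ V, g (U * Su a b s hs V) ∂μ ∂μ = ∫ U, g U ∂μ := by
  have hSu := Su_cont (a := a) (b := b) s hs
  have hc : Continuous (Function.uncurry fun U V => g (U * Su a b s hs V)) := by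
    unfold Function.uncurry; fun_prop
  rw [integral_integral_swap]
  · simp only [int_right]; simp
  · exact hc.integrable_of_hasCompactSupport (HasCompactSupport.of_compactSpace _)

lemma exp_step {L B l : ℝ} {g : UG N → ℝ} {D : UG N → Mt N → ℝ} (hG : Good L B l g D)
    (hab : a ≠ b) (s : ℝ) (hs : s ^ 2 ≤ 1) (hs0 : 0 ≤ s) (r : ℝ) (hr : |r| * (8 * L * s) ≤ 1) :
    ∫ U, Real.exp (r * g U) ∂μ
      ≤ Real.exp (r ^ 2 * (3 / 2 * s ^ 2 * (qc μ a b * l ^ 2) + 3 * (16 * B + 2 * L) ^ 2 * s ^ 4))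
        * ∫ U, Real.exp (r * Pg μ a b s hs g U) ∂μ := by
  have hSu := Su_cont (a := a) (b := b) s hs
  have hcg := hG.cg
  have hP := Pg_cont μ (a := a) (b := b) s hs hG.cg
  have c0 : Continuous fun U => Real.exp (r * g U) := by fun_prop
  rw [← int_step μ (a := a) (b := b) c0 s hs, ← integral_const_mul]
  refine integral_mono (ci μ ?_) (ci μ (by fun_prop)) fun U => loc_exp μ hG hab s hs hs0 r hr U
  exact Pg_cont μ s hs c0

lemma iterate {L B : ℝ} (hab : a ≠ b) (s : ℝ) (hs : s ^ 2 ≤ 1) (hs0 : 0 < s) (θ : ℝ) (hθ0 : 0 ≤ θ)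
    (hθ : θ = 1 - N * s ^ 2 * qc μ a b / 2) (r : ℝ) (hr : |r| * (8 * L * s) ≤ 1) (n : ℕ) :
    ∀ (l : ℝ) (g : UG N → ℝ) (D : UG N → Mt N → ℝ), Good L B l g D →
    ∃ G DG, Good L B (l * √θ ^ n) G DG ∧ ∀ r' : ℝ, r' = r ∨ r' = -r →
      ∫ U, Real.exp (r' * g U) ∂μ ≤ Real.exp (r ^ 2 * (3 * l ^ 2 / N * (1 - θ ^ n)
        + 3 * (16 * B + 2 * L) ^ 2 * (n * s ^ 4))) * ∫ U, Real.exp (r' * G U) ∂μ := by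
  have hN : (0 : ℝ) < N := by
    have : N ≠ 0 := by rintro rfl; exact a.elim0
    positivity
  induction n with
  | zero =>
    intro l g D hG
    exact ⟨g, D, by simpa using hG, fun r' _ => by simp⟩
  | succ n ih =>
    intro l g D hG
    obtain ⟨G, DG, h1, h2⟩ := ih _ _ _ (good_step μ hG hab s hs θ hθ0 hθ)
    refine ⟨G, DG, by rw [pow_succ', ← mul_assoc]; exact h1, fun r' hr' => ?_⟩
    have hra : |r'| = |r| := by rcases hr' with rfl | rfl <;> simp
    have hrs : r' ^ 2 = r ^ 2 := by rcases hr' with rfl | rfl <;> simp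
    have h3 := exp_step μ hG hab s hs hs0.le r' (by rw [hra]; exact hr)
    refine h3.trans ((mul_le_mul_of_nonneg_left (h2 r' hr') (Real.exp_pos _).le).trans (le_of_eq ?_))
    rw [← mul_assoc, ← Real.exp_add, hrs]
    congr 2
    rw [mul_pow, Real.sq_sqrt hθ0]
    have e : 3 / 2 * s ^ 2 * (qc μ a b * l ^ 2) = 3 * l ^ 2 / N * (1 - θ) := by
      rw [hθ]; field_simp; ring
    rw [e]
    push_cast
    ring

end Step5

end
section
open scoped Matrix.Norms.L2Operator

lemma exists_log {N : ℕ} (W : UG N) : ∃ K : Mt N, Kᴴ = -K ∧ NormedSpace.exp K = (W : Mt N) := by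
  have hn : IsStarNormal (W : Mt N) := by infer_instance
  have hfin : (spectrum ℂ (W : Mt N)).Finite := Matrix.finite_spectrum _
  have hcont : ∀ f : ℂ → ℂ, ContinuousOn f (spectrum ℂ (W : Mt N)) := fun f => hfin.continuousOn f
  have hunit : ∀ z ∈ spectrum ℂ (W : Mt N), ‖z‖ = 1 := fun z hz => by
    simpa using spectrum.subset_circle_of_unitary W.2 hz
  refine ⟨cfc (fun z => Complex.I * (Complex.arg z : ℂ)) (W : Mt N), ?_, ?_⟩
  · rw [← star_eq_conjTranspose, ← cfc_star, ← cfc_neg]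
    congr 1
    funext z
    simp
  · rw [← CFC.exp_eq_normedSpace_exp (𝕜 := ℂ), ← cfc_comp' _ _ _ (by fun_prop) (hcont _)]
    conv_rhs => rw [← cfc_id ℂ (W : Mt N)]
    apply cfc_congr
    intro z hz
    have := Complex.norm_mul_exp_arg_mul_I z
    rw [hunit z hz] at this
    simp only [id]
    rw [← Complex.exp_eq_exp_ℂ, mul_comm]
    simpa using this

end
section
open scoped Matrix.Norms.Frobenius
variable {N : ℕ}

lemma path_lemma {L B l : ℝ} {g : UG N → ℝ} {D : UG N → Mt N → ℝ} (hG : Good L B l g D)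
    (U : UG N) (A : Mt N) (hA : Aᴴ = -A) (hA0 : trace A = 0) :
    |g (U * eU A hA) - g U| ≤ l * ‖A‖ := by
  apply le_of_forall_pos_le_add
  intro η hη
  have hL0 := hG.L0
  have hB0 := hG.B0
  set ε := min 1 (η / (2 * (L + 1))) with hε
  have hε0 : 0 < ε := by positivity
  have hε1 : ε ≤ 1 := min_le_left _ _
  have hLε : L * ε ≤ η / 2 := by
    have : ε ≤ η / (2 * (L + 1)) := min_le_right _ _
    rw [le_div_iff₀ (by positivity)] at this
    nlinarith
  obtain ⟨δ, hδ, hE⟩ := eU_small A hε0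
  obtain ⟨n, hn⟩ := exists_nat_gt (max (1 / δ) (2 * B * (‖A‖ + 1) ^ 2 / η))
  have hn1 := (le_max_left _ _).trans_lt hn
  have hn2 := (le_max_right _ _).trans_lt hn
  have hn0 : (0 : ℝ) < n := lt_trans (by positivity) hn1
  set t : ℝ := 1 / n with ht
  have ht0 : 0 < t := by positivity
  have htδ : |t| < δ := by
    rw [abs_of_pos ht0, ht, div_lt_comm₀ hn0 hδ]; exact hn1
  have hE := hE t htδ
  rw [abs_of_pos ht0] at hE
  set e : UG N := eU (t • A) (skew_smul hA t) with he
  have hee : (e : Mt N) = NormedSpace.exp (t • A) := rfl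
  rw [← hee] at hE
  have he1 : ‖(e : Mt N) - 1‖ ≤ t * (‖A‖ + 1) := by
    have : (e : Mt N) - 1 = t • A + ((e : Mt N) - 1 - t • A) := by abel
    rw [this]
    refine (norm_add_le _ _).trans ?_
    rw [norm_smul, Real.norm_of_nonneg ht0.le]; nlinarith
  have one : ∀ W : UG N, |g (W * e) - g W| ≤ t * (l * ‖A‖ + L * ε) + B * (t * (‖A‖ + 1)) ^ 2 := by
    intro W
    have h1 := hG.tay W (W * e)
    have hm : ((W * e : UG N) : Mt N) - (W : Mt N) = (W : Mt N) * ((e : Mt N) - 1) := by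
      rw [Matrix.mul_sub, Matrix.mul_one]; rfl
    rw [hm, norm_U_mul] at h1
    have h2 := hG.Dle W ((W : Mt N) * ((e : Mt N) - 1 - t • A))
    rw [norm_U_mul, Matrix.mul_sub, (hG.lin _).map_sub, Matrix.mul_smul, (hG.lin _).map_smul,
      smul_eq_mul] at h2
    have h3 := hG.tan W A hA hA0
    have h4 : B * ‖(e : Mt N) - 1‖ ^ 2 ≤ B * (t * (‖A‖ + 1)) ^ 2 := by gcongr
    have h5 := mul_le_mul_of_nonneg_left hE hL0
    have h6 : |t * D W ((W : Mt N) * A)| ≤ t * (l * ‖A‖) := by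
      rw [abs_mul, abs_of_pos ht0]; gcongr
    rw [abs_le] at *
    constructor <;> linarith [h1.1, h1.2, h2.1, h2.2, h6.1, h6.2]
  have many : ∀ k : ℕ, |g (U * e ^ k) - g U|
      ≤ k * (t * (l * ‖A‖ + L * ε) + B * (t * (‖A‖ + 1)) ^ 2) := by
    intro k
    induction k with
    | zero => simp
    | succ k ih =>
      have h1 := one (U * e ^ k)
      rw [mul_assoc, ← pow_succ] at h1
      have := abs_add_le (g (U * e ^ (k + 1)) - g (U * e ^ k)) (g (U * e ^ k) - g U)
      rw [sub_add_sub_cancel] at this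
      push_cast
      linarith
  have hen : e ^ n = eU A hA := by
    apply Subtype.ext
    change (e : Mt N) ^ n = NormedSpace.exp A
    rw [hee, ← Matrix.exp_nsmul]
    congr 1
    rw [← Nat.cast_smul_eq_nsmul ℝ, smul_smul, ht, mul_one_div_cancel hn0.ne', one_smul]
  have h := many n
  rw [hen] at h
  have hnt : n * t = 1 := by rw [ht]; field_simp
  have h7 : (n : ℝ) * (t * (l * ‖A‖ + L * ε) + B * (t * (‖A‖ + 1)) ^ 2)
      = (n * t) * (l * ‖A‖ + L * ε) + (n * t) * (t * (B * (‖A‖ + 1) ^ 2)) := by ring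
  rw [h7, hnt] at h
  have h8 : t * (B * (‖A‖ + 1) ^ 2) ≤ η / 2 := by
    rw [div_lt_iff₀ hη] at hn2
    rw [ht, one_div_mul_eq_div, div_le_iff₀ hn0]
    linarith
  linarith

lemma dec (a : Fin N) (W : UG N) : ∃ (ψ : ℝ) (A : Mt N) (_ : Aᴴ = -A), trace A = 0 ∧
    ‖A‖ ≤ N * (2 * Real.pi * (N + 2)) ∧ |ψ| ≤ Real.pi / N ∧
    (W : Mt N) = Complex.exp (ψ * Complex.I) • NormedSpace.exp A := by
  obtain ⟨K, hK, hW⟩ := exists_log W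
  obtain ⟨Q, h, e, -, -⟩ := skew_diag K hK
  have hpi := Real.pi_pos
  have hN : (0 : ℝ) < N := by
    have : N ≠ 0 := by rintro rfl; exact a.elim0
    positivity
  have hN1 : (1 : ℝ) ≤ N := by
    have : N ≠ 0 := by rintro rfl; exact a.elim0
    exact_mod_cast Nat.one_le_iff_ne_zero.2 this
  -- reduce the angles
  have h1 : ∀ k, ∃ x : ℝ, |x| ≤ Real.pi ∧ ∃ m : ℤ, x = h k - 2 * Real.pi * m := by
    intro k
    refine ⟨h k - 2 * Real.pi * round (h k / (2 * Real.pi)), ?_, _, rfl⟩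
    have := abs_sub_round (h k / (2 * Real.pi))
    have h2 : h k - 2 * Real.pi * round (h k / (2 * Real.pi))
      = 2 * Real.pi * (h k / (2 * Real.pi) - round (h k / (2 * Real.pi))) := by field_simp
    rw [h2, abs_mul, abs_of_pos (by positivity)]
    nlinarith
  choose x hx m hm using h1
  set S := ∑ k, x k with hS
  have hSb : |S| ≤ N * Real.pi := by
    refine (Finset.abs_sum_le_sum_abs _ _).trans ?_
    refine (Finset.sum_le_sum fun i _ => hx i).trans ?_
    simp
  set M : ℤ := round (S / (2 * Real.pi)) with hM
  have hSM : |S - 2 * Real.pi * M| ≤ Real.pi := by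
    have := abs_sub_round (S / (2 * Real.pi))
    have h2 : S - 2 * Real.pi * M = 2 * Real.pi * (S / (2 * Real.pi) - M) := by field_simp
    rw [h2, abs_mul, abs_of_pos (by positivity)]
    nlinarith
  have hMb : |2 * Real.pi * M| ≤ (N + 1) * Real.pi := by
    have := abs_sub S (S - 2 * Real.pi * M)
    rw [sub_sub_cancel] at this
    linarith
  set φ : Fin N → ℝ := fun k => x k - if k = a then 2 * Real.pi * M else 0 with hφ
  have hφS : ∑ k, φ k = S - 2 * Real.pi * M := by
    rw [hφ]; simp [Finset.sum_sub_distrib, hS]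
  have hφb : ∀ k, |φ k| ≤ (N + 2) * Real.pi := by
    intro k
    refine (abs_sub _ _).trans ?_
    have : |if k = a then 2 * Real.pi * M else 0| ≤ (N + 1) * Real.pi := by
      split_ifs
      · exact hMb
      · simp; positivity
    linarith [hx k]
  have hφe : ∀ k, Complex.exp (φ k * Complex.I) = Complex.exp (h k * Complex.I) := by
    intro k
    rw [Complex.exp_eq_exp_iff_exists_int]
    refine ⟨-(m k) - if k = a then M else 0, ?_⟩
    simp only [hφ, hm]
    split_ifs <;> push_cast <;> ring
  set ψ := (∑ k, φ k) / N with hψ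
  have hψb : |ψ| ≤ Real.pi / N := by
    rw [hψ, hφS, abs_div, abs_of_pos hN]
    gcongr
  have hψb2 : |ψ| ≤ Real.pi := hψb.trans (div_le_self hpi.le hN1)
  set y : Fin N → ℝ := fun k => φ k - ψ with hy
  have hyS : ∑ k, y k = 0 := by
    rw [hy]; simp [Finset.sum_sub_distrib, hψ]; field_simp; ring
  have hyb : ∀ k, |y k| ≤ 2 * Real.pi * (N + 2) := by
    intro k
    refine (abs_sub _ _).trans ?_
    nlinarith [hφb k]
  set A : Mt N := (Q : Mt N) * Matrix.diagonal (fun k => Complex.I * (y k : ℂ)) * (Q : Mt N)ᴴ with hA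
  have hexp : ∀ z : Fin N → ℝ, NormedSpace.exp ((Q : Mt N) * Matrix.diagonal (fun k => Complex.I * (z k : ℂ)) * (Q : Mt N)ᴴ)
      = (Q : Mt N) * Matrix.diagonal (fun k => Complex.exp (z k * Complex.I)) * (Q : Mt N)ᴴ := by
    intro z
    have hQ : (Q : Mt N)⁻¹ = (Q : Mt N)ᴴ := Matrix.inv_eq_right_inv (U_mul_star Q)
    have hQu : IsUnit (Q : Mt N) := ⟨⟨Q, (Q : Mt N)ᴴ, U_mul_star Q, star_U_mul Q⟩, rfl⟩
    rw [← hQ, Matrix.exp_conj _ _ hQu, Matrix.exp_diagonal]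
    congr 3
    funext k
    rw [Pi.exp_def]
    simp only
    rw [← Complex.exp_eq_exp_ℂ, mul_comm]
  refine ⟨ψ, A, ?_, ?_, ?_, hψb, ?_⟩
  · rw [hA, conjTranspose_mul, conjTranspose_mul, conjTranspose_conjTranspose, diagonal_conjTranspose,
      ← Matrix.mul_assoc, ← Matrix.neg_mul, ← Matrix.mul_neg, Matrix.diagonal_neg]
    congr 3
    funext k
    simp
  · rw [hA, trace_conj, Matrix.trace_diagonal, ← Finset.mul_sum, ← Complex.ofReal_sum, hyS]
    simp
  · rw [hA, norm_mul_Us, norm_U_mul]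
    have hR : 0 ≤ N * (2 * Real.pi * (N + 2)) := by positivity
    refine abs_le_of_sq_le_sq' ?_ hR |>.2
    rw [norm_diagI_sq]
    have : ∀ k, y k ^ 2 ≤ (2 * Real.pi * (N + 2)) ^ 2 := fun k => by
      rw [← sq_abs]; exact pow_le_pow_left₀ (abs_nonneg _) (hyb k) 2
    refine (Finset.sum_le_sum fun k _ => this k).trans ?_
    simp only [Finset.sum_const, Finset.card_univ, Fintype.card_fin, nsmul_eq_mul]
    rw [mul_pow (N : ℝ)]
    gcongr
    nlinarith
  · rw [← hW, e, hexp, hA, hexp, ← Matrix.smul_mul, ← Matrix.mul_smul, ← Matrix.diagonal_smul]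
    congr 3
    funext k
    simp only [Pi.smul_apply, smul_eq_mul]
    rw [← Complex.exp_add, ← hφe]
    congr 1
    simp only [hy]
    push_cast; ring

lemma osc {L B l : ℝ} {g : UG N → ℝ} {D : UG N → Mt N → ℝ} (hG : Good L B l g D) (a : Fin N)
    (U U' : UG N) : |g U' - g U| ≤ L * (Real.pi / √N) + l * (N * (2 * Real.pi * (N + 2))) := by
  obtain ⟨ψ, A, hA, hA0, hAn, hψ, hW⟩ := dec a (U⁻¹ * U')
  have h1 := path_lemma hG U A hA hA0
  have h2 := hG.lip U' (U * eU A hA)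
  have e1 : (U' : Mt N) = Complex.exp (ψ * Complex.I) • ((U * eU A hA : UG N) : Mt N) := by
    have : U' = U * (U⁻¹ * U') := by simp
    conv_lhs => rw [this]
    change (U : Mt N) * ((U⁻¹ * U' : UG N) : Mt N) = _ • ((U : Mt N) * NormedSpace.exp A)
    rw [hW, Matrix.mul_smul]
  have hN : (0 : ℝ) < N := by
    have : N ≠ 0 := by rintro rfl; exact a.elim0
    positivity
  have e2 : ‖(U' : Mt N) - ((U * eU A hA : UG N) : Mt N)‖ ≤ Real.pi / √N := by
    set V := U * eU A hA
    have hV : ‖(V : Mt N)‖ = √N := by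
      have h : ‖(V : Mt N)‖ ^ 2 = N := by
        rw [← ip_self, ip, star_U_mul]; simp
      rw [← h, Real.sqrt_sq (norm_nonneg _)]
    have : (U' : Mt N) - (V : Mt N) = (Complex.exp (ψ * Complex.I) - 1) • (V : Mt N) := by
      rw [e1, sub_smul, one_smul]
    rw [this, norm_smul, hV]
    have h3 : ‖Complex.exp (ψ * Complex.I) - 1‖ ≤ Real.pi / N := by
      refine le_trans ?_ hψ
      have := Real.norm_exp_I_mul_ofReal_sub_one_le (x := ψ)
      rw [mul_comm] at this
      simpa using this
    have h4 : √(N : ℝ) * √N = N := Real.mul_self_sqrt hN.le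
    have h5 : 0 < √(N : ℝ) := Real.sqrt_pos.2 hN
    calc _ ≤ Real.pi / N * √N := by gcongr
      _ = Real.pi / √N := by
        rw [div_mul_eq_mul_div, div_eq_div_iff hN.ne' h5.ne', mul_assoc, h4]
  have h3 := mul_le_mul_of_nonneg_left e2 hG.L0
  have h4 := mul_le_mul_of_nonneg_left hAn hG.l0
  have h5 := abs_add_le (g U' - g (U * eU A hA)) (g (U * eU A hA) - g U)
  rw [sub_add_sub_cancel] at h5
  linarith

section Step7
set_option linter.unusedSectionVars false
variable [MeasurableSpace (UG N)] [BorelSpace (UG N)]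
  (μ : Measure (UG N)) [IsProbabilityMeasure μ] [μ.IsMulLeftInvariant]
variable {a b : Fin N}

lemma symm_bound {G : UG N → ℝ} (hG : Continuous G) (r M : ℝ) (hM : ∀ U V, |G U - G V| ≤ M) :
    (∫ U, Real.exp (r * G U) ∂μ) * (∫ U, Real.exp (-r * G U) ∂μ) ≤ Real.exp (r ^ 2 * M ^ 2 / 2) := by
  set p := ∫ U, Real.exp (r * G U) ∂μ with hp
  set q := ∫ U, Real.exp (-r * G U) ∂μ with hq
  have inner : ∀ U, Real.exp (r * G U) * q + Real.exp (-r * G U) * p ≤ 2 * Real.exp (r ^ 2 * M ^ 2 / 2) := by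
    intro U
    rw [hp, hq, ← integral_const_mul, ← integral_const_mul,
      ← integral_add (ci μ (by fun_prop)) (ci μ (by fun_prop))]
    have : 2 * Real.exp (r ^ 2 * M ^ 2 / 2) = ∫ V : UG N, 2 * Real.exp (r ^ 2 * M ^ 2 / 2) ∂μ := by simp
    rw [this]
    refine integral_mono (ci μ (by fun_prop)) (integrable_const _) fun V => ?_
    simp only
    rw [← Real.exp_add, ← Real.exp_add]
    have h1 := Real.cosh_le_exp_half_sq (r * (G U - G V))
    rw [Real.cosh_eq] at h1
    have h2 : Real.exp ((r * (G U - G V)) ^ 2 / 2) ≤ Real.exp (r ^ 2 * M ^ 2 / 2) := by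
      rw [mul_pow]
      have : (G U - G V) ^ 2 ≤ M ^ 2 := by
        rw [← sq_abs]; exact pow_le_pow_left₀ (abs_nonneg _) (hM U V) 2
      gcongr
    rw [show r * G U + -r * G V = r * (G U - G V) by ring,
      show -r * G U + r * G V = -(r * (G U - G V)) by ring]
    linarith
  have outer : ∫ U, (Real.exp (r * G U) * q + Real.exp (-r * G U) * p) ∂μ
      ≤ ∫ U : UG N, 2 * Real.exp (r ^ 2 * M ^ 2 / 2) ∂μ :=
    integral_mono (ci μ (by fun_prop)) (integrable_const _) inner
  rw [integral_add (ci μ (by fun_prop)) (ci μ (by fun_prop)), integral_mul_const, integral_mul_const,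
    ← hp, ← hq] at outer
  simp at outer
  linarith

lemma good_bound {L B : ℝ} {g : UG N → ℝ} {D : UG N → Mt N → ℝ} (hG : Good L B L g D)
    (hab : a ≠ b) (r : ℝ) :
    (∫ U, Real.exp (r * g U) ∂μ) * (∫ U, Real.exp (-r * g U) ∂μ)
      ≤ Real.exp (11 * r ^ 2 * L ^ 2 / N) := by
  have hN : (0 : ℝ) < N := by
    have : N ≠ 0 := by rintro rfl; exact a.elim0
    positivity
  have hq := qc_pos μ hab
  set q := qc μ a b with hqd
  set K := 16 * B + 2 * L with hK
  set R : ℝ := N * (2 * Real.pi * (N + 2)) with hR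
  have hL0 := hG.L0
  have hR0 : 0 ≤ R := by positivity
  have ev : ∀ᶠ j : ℕ in Filter.atTop,
      (∫ U, Real.exp (r * g U) ∂μ) * (∫ U, Real.exp (-r * g U) ∂μ)
      ≤ Real.exp (2 * (r ^ 2 * (3 * L ^ 2 / N + 3 * K ^ 2 * (1 / (j : ℝ))))
        + r ^ 2 * (L * (Real.pi / √N) + L * Real.exp (-(N * q / 4 * j)) * R) ^ 2 / 2) := by
    have t1 : Filter.Tendsto (fun j : ℕ => (j : ℝ)) Filter.atTop Filter.atTop := tendsto_natCast_atTop_atTop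
    filter_upwards [Filter.eventually_ge_atTop 1, t1.eventually_ge_atTop (N * q / 2),
      t1.eventually_ge_atTop (|r| * (8 * L))] with j hj1 hj2 hj3
    have hj1' : (1 : ℝ) ≤ j := by exact_mod_cast hj1
    have hj0 : (0 : ℝ) < j := by linarith
    set s : ℝ := 1 / j with hs
    have hs0 : 0 < s := by positivity
    have hs1 : s ≤ 1 := by rw [hs, div_le_one hj0]; exact hj1'
    have hs2 : s ^ 2 ≤ 1 := by nlinarith
    set θ := 1 - N * s ^ 2 * q / 2 with hθ
    have hθ0 : 0 ≤ θ := by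
      have : N * s ^ 2 * q / 2 ≤ 1 := by
        have e : N * s ^ 2 * q / 2 = (N * q / 2) / (j * j) := by rw [hs]; field_simp
        rw [e, div_le_one (by positivity)]
        nlinarith
      linarith
    have hr : |r| * (8 * L * s) ≤ 1 := by
      have e : |r| * (8 * L * s) = |r| * (8 * L) / j := by rw [hs]; ring
      rw [e, div_le_one hj0]; exact hj3
    obtain ⟨G, DG, hGG, hb⟩ := iterate μ (B := B) hab s hs2 hs0 θ hθ0 hθ r hr (j ^ 3) L g D hG
    have hθn : √θ ^ (j ^ 3) ≤ Real.exp (-(N * q / 4 * j)) := by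
      have h1 : √θ ≤ Real.exp (-(N * q / 4 * s ^ 2)) := by
        apply Real.sqrt_le_iff.2 ⟨(Real.exp_pos _).le, ?_⟩
        rw [← Real.exp_nat_mul, hθ]
        have := Real.add_one_le_exp (-(N * s ^ 2 * q / 2))
        refine le_trans (by linarith) (this.trans (le_of_eq ?_))
        congr 1; push_cast; ring
      refine (pow_le_pow_left₀ (Real.sqrt_nonneg _) h1 _).trans (le_of_eq ?_)
      rw [← Real.exp_nat_mul]
      congr 1
      rw [hs]; push_cast; field_simp
    have hosc : ∀ U V, |G U - G V| ≤ L * (Real.pi / √N) + L * Real.exp (-(N * q / 4 * j)) * R := by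
      intro U V
      refine (osc hGG a V U).trans ?_
      gcongr
    have h1 := hb r (Or.inl rfl)
    have h2 := hb (-r) (Or.inr rfl)
    have h3 := symm_bound μ hGG.cg r _ hosc
    set c := r ^ 2 * (3 * L ^ 2 / N * (1 - θ ^ (j ^ 3)) + 3 * (16 * B + 2 * L) ^ 2 * ((j ^ 3 : ℕ) * s ^ 4)) with hc
    have hcle : c ≤ r ^ 2 * (3 * L ^ 2 / N + 3 * K ^ 2 * (1 / (j : ℝ))) := by
      have e : ((j ^ 3 : ℕ) : ℝ) * s ^ 4 = 1 / j := by
        rw [hs]; push_cast; field_simp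
      rw [hc, e]
      have : 3 * L ^ 2 / N * (1 - θ ^ (j ^ 3)) ≤ 3 * L ^ 2 / N := by
        have h5 : 0 ≤ θ ^ (j ^ 3) := by positivity
        have h6 : 0 ≤ 3 * L ^ 2 / N := by positivity
        nlinarith
      gcongr
    have p1 : 0 ≤ ∫ U, Real.exp (r * G U) ∂μ := integral_nonneg fun U => (Real.exp_pos _).le
    have p2 : 0 ≤ ∫ U, Real.exp (-r * G U) ∂μ := integral_nonneg fun U => (Real.exp_pos _).le
    have p3 : 0 ≤ ∫ U, Real.exp (-r * g U) ∂μ := integral_nonneg fun U => (Real.exp_pos _).le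
    calc _ ≤ (Real.exp c * ∫ U, Real.exp (r * G U) ∂μ) * (Real.exp c * ∫ U, Real.exp (-r * G U) ∂μ) := by
          exact mul_le_mul h1 h2 p3 (by positivity)
      _ = Real.exp (2 * c) * ((∫ U, Real.exp (r * G U) ∂μ) * ∫ U, Real.exp (-r * G U) ∂μ) := by
          rw [two_mul, Real.exp_add]; ring
      _ ≤ Real.exp (2 * (r ^ 2 * (3 * L ^ 2 / N + 3 * K ^ 2 * (1 / (j : ℝ))))) *
          Real.exp (r ^ 2 * (L * (Real.pi / √N) + L * Real.exp (-(N * q / 4 * j)) * R) ^ 2 / 2) := by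
          refine mul_le_mul (Real.exp_le_exp.2 (by linarith)) h3 (mul_nonneg p1 p2) (Real.exp_pos _).le
      _ = _ := by rw [← Real.exp_add]
  have lim : Filter.Tendsto (fun j : ℕ => Real.exp (2 * (r ^ 2 * (3 * L ^ 2 / N + 3 * K ^ 2 * (1 / (j : ℝ))))
        + r ^ 2 * (L * (Real.pi / √N) + L * Real.exp (-(N * q / 4 * j)) * R) ^ 2 / 2)) Filter.atTop
      (nhds (Real.exp (2 * (r ^ 2 * (3 * L ^ 2 / N + 3 * K ^ 2 * 0))
        + r ^ 2 * (L * (Real.pi / √N) + L * 0 * R) ^ 2 / 2))) := by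
    have l1 : Filter.Tendsto (fun j : ℕ => 1 / (j : ℝ)) Filter.atTop (nhds 0) :=
      tendsto_one_div_atTop_nhds_zero_nat
    have l2 : Filter.Tendsto (fun j : ℕ => Real.exp (-(N * q / 4 * j))) Filter.atTop (nhds 0) :=
      Real.tendsto_exp_neg_atTop_nhds_zero.comp
        (tendsto_natCast_atTop_atTop.const_mul_atTop (by positivity))
    refine (Real.continuous_exp.tendsto _).comp ?_
    exact ((l1.const_mul _).const_add _ |>.const_mul _ |>.const_mul _).add
      (((((l2.const_mul _).mul_const _).const_add _).pow 2).const_mul _ |>.div_const _)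
  refine (ge_of_tendsto lim ev).trans ?_
  apply Real.exp_le_exp.2
  have h5 : (Real.pi / √N) ^ 2 = Real.pi ^ 2 / N := by rw [div_pow, Real.sq_sqrt hN.le]
  have h6 : Real.pi ^ 2 ≤ 10 := by nlinarith [Real.pi_lt_d2, Real.pi_pos]
  have e : 2 * (r ^ 2 * (3 * L ^ 2 / N + 3 * K ^ 2 * 0))
        + r ^ 2 * (L * (Real.pi / √N) + L * 0 * R) ^ 2 / 2
      = (6 + Real.pi ^ 2 / 2) * (r ^ 2 * L ^ 2 / N) := by
    rw [mul_zero, mul_zero, zero_mul, add_zero, add_zero, mul_pow, h5]; ring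
  rw [e]
  have h7 : 0 ≤ r ^ 2 * L ^ 2 / N := by positivity
  calc _ ≤ 11 * (r ^ 2 * L ^ 2 / N) := by gcongr; linarith
    _ = _ := by ring

end Step7

end
section

lemma smooth_approx {E : Type*} [NormedAddCommGroup E] [NormedSpace ℝ E] [FiniteDimensional ℝ E]
    (F : E → ℝ) (L : ℝ) (hL : 0 ≤ L) (hF : ∀ x y, |F x - F y| ≤ L * ‖x - y‖) (ε : ℝ) (hε : 0 < ε) :
    ∃ g : E → ℝ, ContDiff ℝ 2 g ∧ (∀ x y, |g x - g y| ≤ L * ‖x - y‖) ∧ ∀ x, |g x - F x| ≤ ε := by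
  let _ : MeasurableSpace E := borel E
  have _ : BorelSpace E := ⟨rfl⟩
  have hlip : LipschitzWith ⟨L, hL⟩ F := LipschitzWith.of_dist_le_mul fun x y => by
    rw [dist_eq_norm, dist_eq_norm]; exact hF x y
  have hFc : Continuous F := hlip.continuous
  set μ : Measure E := Measure.addHaar with hμ
  set δ := ε / (L + 1) with hδ
  have hδ0 : 0 < δ := by positivity
  let φ : ContDiffBump (0 : E) := ⟨δ / 2, δ, by positivity, by linarith⟩
  set g : E → ℝ := convolution (φ.normed μ) F (ContinuousLinearMap.lsmul ℝ ℝ) μ with hg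
  have h_intg : ∀ x, Integrable (fun t => φ.normed μ t * F (x - t)) μ := by
    intro x
    refine Continuous.integrable_of_hasCompactSupport ?_ ?_
    · have := φ.continuous_normed (μ := μ)
      fun_prop
    · exact φ.hasCompactSupport_normed.mul_right
  have hgx : ∀ x, g x = ∫ t, φ.normed μ t * F (x - t) ∂μ := fun x => rfl
  refine ⟨g, ?_, ?_, ?_⟩
  · have h := HasCompactSupport.contDiff_convolution_left (𝕜 := ℝ) (n := 2) (μ := μ) (E := ℝ)
      (E' := ℝ) (F := ℝ) (ContinuousLinearMap.lsmul ℝ ℝ : ℝ →L[ℝ] ℝ →L[ℝ] ℝ)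
      (φ.hasCompactSupport_normed (μ := μ)) (φ.contDiff_normed (μ := μ))
      (hFc.locallyIntegrable (μ := μ))
    exact h
  · intro x y
    rw [hgx, hgx, ← integral_sub (h_intg x) (h_intg y), ← Real.norm_eq_abs]
    calc _ ≤ ∫ t, φ.normed μ t * (L * ‖x - y‖) ∂μ := by
          refine (norm_integral_le_integral_norm _).trans ?_
          refine integral_mono ((h_intg x).sub (h_intg y)).norm (φ.integrable_normed.mul_const _) fun t => ?_
          simp only
          rw [← mul_sub, norm_mul, Real.norm_of_nonneg (φ.nonneg_normed t)]
          refine mul_le_mul_of_nonneg_left ?_ (φ.nonneg_normed t)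
          have := hF (x - t) (y - t)
          rw [sub_sub_sub_cancel_right] at this
          exact this
      _ = _ := by rw [integral_mul_const, φ.integral_normed, one_mul]
  · intro x
    have := φ.dist_normed_convolution_le (μ := μ) (g := F) (x₀ := x) (ε := ε)
      hFc.aestronglyMeasurable ?_
    · rwa [Real.dist_eq] at this
    · intro y hy
      rw [Real.dist_eq]
      refine (hF y x).trans ?_
      have h1 : ‖y - x‖ ≤ δ := by
        rw [← dist_eq_norm]; exact (Metric.mem_ball.1 hy).le
      have h2 : L * δ ≤ ε := by
        rw [hδ, mul_div_assoc', div_le_iff₀ (by linarith)]; nlinarith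
      exact (mul_le_mul_of_nonneg_left h1 hL).trans h2

lemma taylor_ball {E : Type*} [NormedAddCommGroup E] [NormedSpace ℝ E] [FiniteDimensional ℝ E]
    (g : E → ℝ) (hg : ContDiff ℝ 2 g) (R : ℝ) : ∃ B : ℝ, 0 ≤ B ∧ ∀ x y, ‖x‖ ≤ R → ‖y‖ ≤ R →
      |g y - g x - fderiv ℝ g x (y - x)| ≤ B * ‖y - x‖ ^ 2 := by
  have h1 : ContDiff ℝ 1 (fderiv ℝ g) := hg.fderiv_right (by norm_num)
  have hll : LocallyLipschitz (fderiv ℝ g) := h1.locallyLipschitz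
  obtain ⟨K, hK⟩ := (hll.locallyLipschitzOn (s := Metric.closedBall (0 : E) R)).exists_lipschitzOnWith_of_compact
    (isCompact_closedBall 0 R)
  refine ⟨K, K.2, fun x y hx hy => ?_⟩
  have hseg : segment ℝ x y ⊆ Metric.closedBall (0 : E) R :=
    (convex_closedBall 0 R).segment_subset (by simpa using hx) (by simpa using hy)
  have := Convex.norm_image_sub_le_of_norm_hasFDerivWithin_le' (𝕜 := ℝ) (f := g) (f' := fderiv ℝ g)
    (φ := fderiv ℝ g x) (s := segment ℝ x y) (C := K * ‖y - x‖) (x := x) (y := y)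
    (fun z _ => (hg.differentiable (by norm_num) z).hasFDerivAt.hasFDerivWithinAt) ?_ (convex_segment x y)
    (left_mem_segment ℝ x y) (right_mem_segment ℝ x y)
  · rw [Real.norm_eq_abs] at this
    refine this.trans (le_of_eq (by ring))
  · intro z hz
    have h2 := hK.dist_le_mul z (hseg hz) x (by simpa using hx)
    rw [dist_eq_norm, dist_eq_norm] at h2
    refine h2.trans ?_
    gcongr
    exact norm_sub_le_of_mem_segment hz

lemma smooth_pkg {E : Type*} [NormedAddCommGroup E] [NormedSpace ℝ E] [FiniteDimensional ℝ E]
    (F : E → ℝ) (L : ℝ) (hL : 0 ≤ L) (hF : ∀ x y, |F x - F y| ≤ L * ‖x - y‖) (ε : ℝ) (hε : 0 < ε)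
    (R : ℝ) :
    ∃ (B : ℝ) (g : E → ℝ) (D : E → E → ℝ), 0 ≤ B ∧ Continuous g ∧
      Continuous (fun p : E × E => D p.1 p.2) ∧ (∀ x, IsLinearMap ℝ (D x)) ∧
      (∀ x y, |g x - g y| ≤ L * ‖x - y‖) ∧ (∀ x, |g x - F x| ≤ ε) ∧
      (∀ x H, |D x H| ≤ L * ‖H‖) ∧
      ∀ x y, ‖x‖ ≤ R → ‖y‖ ≤ R → |g y - g x - D x (y - x)| ≤ B * ‖y - x‖ ^ 2 := by
  obtain ⟨g, hgc, hgl, hgF⟩ := smooth_approx F L hL hF ε hε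
  obtain ⟨B, hB, hT⟩ := taylor_ball g hgc R
  have hD : ∀ (x H : E), |fderiv ℝ g x H| ≤ L * ‖H‖ := by
    intro x H
    have h1 : LipschitzWith ⟨L, hL⟩ g := LipschitzWith.of_dist_le_mul fun x y => by
      rw [dist_eq_norm, dist_eq_norm]; exact hgl x y
    have h2 : ‖fderiv ℝ g x‖ ≤ L := norm_fderiv_le_of_lipschitz ℝ h1
    exact ((fderiv ℝ g x).le_opNorm H).trans (mul_le_mul_of_nonneg_right h2 (norm_nonneg _))
  refine ⟨B, g, fun x H => fderiv ℝ g x H, hB, hgc.continuous, ?_, ?_, hgl, hgF, hD, hT⟩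
  · have h3 : Continuous (fderiv ℝ g) := hgc.continuous_fderiv (by norm_num)
    exact (h3.comp continuous_fst).clm_apply continuous_snd
  · intro x
    exact (fderiv ℝ g x).toLinearMap.isLinear

end
section
open scoped Matrix.Norms.Frobenius
variable {N : ℕ}

lemma exists_good (f : UG N → ℝ) (L : ℝ) (hL : 0 ≤ L)
    (hf : ∀ U V : UG N, |f U - f V| ≤ L * ‖(U : Mt N) - (V : Mt N)‖) (ε : ℝ) (hε : 0 < ε) :
    ∃ (B : ℝ) (g : UG N → ℝ) (D : UG N → Mt N → ℝ), Good L B L g D ∧ ∀ U, |g U - f U| ≤ ε := by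
  classical
  set F0 : Mt N → ℝ := fun M => if h : M ∈ Matrix.unitaryGroup (Fin N) ℂ then f ⟨M, h⟩ else 0 with hF0
  have hF0U : ∀ U : UG N, F0 U = f U := fun U => by simp [hF0]
  have hl : LipschitzOnWith ⟨L, hL⟩ F0 {M | M ∈ Matrix.unitaryGroup (Fin N) ℂ} := by
    refine LipschitzOnWith.of_dist_le_mul fun x hx y hy => ?_
    rw [dist_eq_norm, dist_eq_norm]
    have := hf ⟨x, hx⟩ ⟨y, hy⟩
    rw [← hF0U, ← hF0U] at this
    exact this
  obtain ⟨F, hFl, hFe⟩ := hl.extend_real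
  have hF : ∀ x y, |F x - F y| ≤ L * ‖x - y‖ := fun x y => by
    have := hFl.dist_le_mul x y
    rwa [dist_eq_norm, dist_eq_norm] at this
  obtain ⟨B, g, D, hB, hgc, hDc, hDl, hgl, hgF, hD, hT⟩ := smooth_pkg F L hL hF ε hε N
  refine ⟨B, fun U => g U, fun U H => D U H, ⟨?_, ?_, ?_, hB, hL, hL, ?_, ?_, ?_, ?_⟩, ?_⟩
  · exact hgc.comp cont_coe
  · exact hDc.comp ((cont_coe.comp continuous_fst).prodMk continuous_snd)
  · intro U
    exact hDl U
  · intro U V; exact hgl U V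
  · intro U H; exact hD U H
  · intro U V; exact hT U V (norm_U U) (norm_U V)
  · intro U A _ _
    refine (hD U _).trans ?_
    rw [norm_U_mul]
  · intro U
    have := hgF U
    rw [← hFe U.2, hF0U] at this
    exact this


lemma lip_bound [MeasurableSpace (UG N)] [BorelSpace (UG N)] (μ : Measure (UG N))
    [IsProbabilityMeasure μ] [μ.IsMulLeftInvariant] {a b : Fin N} (hab : a ≠ b)
    (f : UG N → ℝ) (hfc : Continuous f) (L : ℝ) (hL : 0 ≤ L)
    (hf : ∀ U V : UG N, |f U - f V| ≤ L * ‖(U : Mt N) - (V : Mt N)‖) (r : ℝ) :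
    (∫ U, Real.exp (r * f U) ∂μ) * (∫ U, Real.exp (-r * f U) ∂μ)
      ≤ Real.exp (11 * r ^ 2 * L ^ 2 / N) := by
  have key : ∀ ε : ℝ, 0 < ε → (∫ U, Real.exp (r * f U) ∂μ) * (∫ U, Real.exp (-r * f U) ∂μ)
      ≤ Real.exp (2 * |r| * ε) * Real.exp (11 * r ^ 2 * L ^ 2 / N) := by
    intro ε hε
    obtain ⟨B, g, D, hG, hg⟩ := exists_good f L hL hf ε hε
    have hgc := hG.cg
    have h := good_bound μ hG hab r
    have one : ∀ s : ℝ, |s| = |r| → ∫ U, Real.exp (s * f U) ∂μ ≤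
        Real.exp (|r| * ε) * ∫ U, Real.exp (s * g U) ∂μ := by
      intro s hs
      rw [← integral_const_mul]
      refine integral_mono (ci μ (by fun_prop)) (ci μ (by fun_prop)) fun U => ?_
      simp only
      rw [← Real.exp_add]
      refine Real.exp_le_exp.2 ?_
      have h1 : |s * (g U - f U)| ≤ |r| * ε := by
        rw [abs_mul, hs]; exact mul_le_mul_of_nonneg_left (hg U) (abs_nonneg _)
      have := (abs_le.1 h1).1
      linarith
    calc _ ≤ (Real.exp (|r| * ε) * ∫ U, Real.exp (r * g U) ∂μ) *
          (Real.exp (|r| * ε) * ∫ U, Real.exp (-r * g U) ∂μ) := by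
          refine mul_le_mul (one r rfl) (one (-r) (abs_neg r)) ?_ ?_
          · exact integral_nonneg fun U => (Real.exp_pos _).le
          · exact mul_nonneg (Real.exp_pos _).le (integral_nonneg fun U => (Real.exp_pos _).le)
      _ = Real.exp (2 * |r| * ε) * ((∫ U, Real.exp (r * g U) ∂μ) *
          ∫ U, Real.exp (-r * g U) ∂μ) := by
          rw [show 2 * |r| * ε = |r| * ε + |r| * ε by ring, Real.exp_add]; ring
      _ ≤ _ := mul_le_mul_of_nonneg_left h (Real.exp_pos _).le
  have ht : Filter.Tendsto (fun ε : ℝ => Real.exp (2 * |r| * ε) * Real.exp (11 * r ^ 2 * L ^ 2 / N))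
      (nhdsWithin 0 (Set.Ioi 0)) (nhds (Real.exp (11 * r ^ 2 * L ^ 2 / N))) := by
    have hc : Continuous (fun ε : ℝ => Real.exp (2 * |r| * ε) * Real.exp (11 * r ^ 2 * L ^ 2 / N)) := by
      fun_prop
    have := hc.tendsto 0
    simp only [mul_zero, Real.exp_zero, one_mul] at this
    exact this.mono_left nhdsWithin_le_nhds
  refine ge_of_tendsto ht ?_
  filter_upwards [self_mem_nhdsWithin] with ε hε using key ε hε

lemma lip_continuous (f : UG N → ℝ) (L : ℝ)
    (hf : ∀ U V : UG N, |f U - f V| ≤ L * ‖(U : Mt N) - (V : Mt N)‖) : Continuous f := by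
  refine continuous_iff_continuousAt.2 fun V => ?_
  rw [ContinuousAt, tendsto_iff_norm_sub_tendsto_zero]
  have hc : Continuous fun U : UG N => L * ‖(U : Mt N) - (V : Mt N)‖ :=
    continuous_const.mul ((cont_coe.sub continuous_const).norm)
  have h := hc.tendsto V
  simp only [sub_self, norm_zero, mul_zero] at h
  exact squeeze_zero (fun U => norm_nonneg _) (fun U => hf U V) h

lemma one_sided [MeasurableSpace (UG N)] [BorelSpace (UG N)] (μ : Measure (UG N))
    [IsProbabilityMeasure μ] [μ.IsMulLeftInvariant] (hN : 3 ≤ N)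
    (f : UG N → ℝ) (L : ℝ) (hL : 0 < L)
    (hf : ∀ U V : UG N, |f U - f V| ≤ L * ‖(U : Mt N) - (V : Mt N)‖) (t : ℝ) (ht : 0 < t) :
    (μ.prod μ) {p | t ≤ f p.1 - f p.2} ≤
      ENNReal.ofReal (Real.exp (-(((N : ℝ) - 2) * t ^ 2) / (48 * L ^ 2))) := by
  have hfc := lip_continuous f L hf
  have hN' : (3 : ℝ) ≤ N := by exact_mod_cast hN
  have hab : (⟨0, by omega⟩ : Fin N) ≠ ⟨1, by omega⟩ := by simp
  set r : ℝ := t * ((N : ℝ) - 2) / (24 * L ^ 2) with hr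
  have hr0 : 0 ≤ r := by
    have : (0 : ℝ) ≤ (N : ℝ) - 2 := by linarith
    positivity
  have hb := lip_bound μ hab f hfc L hL.le hf r
  have hmul : ∀ p : UG N × UG N, Real.exp (r * (f p.1 - f p.2)) =
      Real.exp (r * f p.1) * Real.exp (-r * f p.2) := fun p => by
    rw [← Real.exp_add]; congr 1; ring
  have hi : Integrable (fun p : UG N × UG N => Real.exp (r * (f p.1 - f p.2))) (μ.prod μ) := by
    simp only [hmul]
    exact (ci μ (f := fun U => Real.exp (r * f U)) (by fun_prop)).mul_prod
      (ci μ (f := fun U => Real.exp (-r * f U)) (by fun_prop))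
  have hch := ProbabilityTheory.measure_ge_le_exp_mul_mgf (μ := μ.prod μ)
    (X := fun p : UG N × UG N => f p.1 - f p.2) t hr0 hi
  have hmgf : ProbabilityTheory.mgf (fun p : UG N × UG N => f p.1 - f p.2) (μ.prod μ) r =
      (∫ U, Real.exp (r * f U) ∂μ) * (∫ U, Real.exp (-r * f U) ∂μ) := by
    rw [ProbabilityTheory.mgf]
    simp only [hmul]
    exact integral_prod_mul (fun U => Real.exp (r * f U)) (fun U => Real.exp (-r * f U))
  rw [hmgf] at hch
  have hfin : Real.exp (-r * t) * ((∫ U, Real.exp (r * f U) ∂μ) * (∫ U, Real.exp (-r * f U) ∂μ)) ≤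
      Real.exp (-(((N : ℝ) - 2) * t ^ 2) / (48 * L ^ 2)) := by
    refine (mul_le_mul_of_nonneg_left hb (Real.exp_pos _).le).trans ?_
    rw [← Real.exp_add]
    refine Real.exp_le_exp.2 ?_
    have h1 : 11 * r ^ 2 * L ^ 2 / N ≤ 12 * r ^ 2 * L ^ 2 / ((N : ℝ) - 2) := by
      refine div_le_div₀ (by positivity) ?_ (by linarith) (by linarith)
      nlinarith [sq_nonneg (r * L)]
    refine (add_le_add_right h1 _).trans (le_of_eq ?_)
    have h2 : (N : ℝ) - 2 ≠ 0 := by linarith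
    rw [hr]
    field_simp
    ring
  rw [← ENNReal.ofReal_toReal (measure_ne_top (μ.prod μ) _)]
  exact ENNReal.ofReal_le_ofReal (hch.trans hfin)

lemma two_sided [MeasurableSpace (UG N)] [BorelSpace (UG N)] (μ : Measure (UG N))
    [IsProbabilityMeasure μ] [μ.IsMulLeftInvariant] (hN : 3 ≤ N)
    (f : UG N → ℝ) (L : ℝ) (hL : 0 < L)
    (hf : ∀ U V : UG N, |f U - f V| ≤ L * ‖(U : Mt N) - (V : Mt N)‖) (t : ℝ) (ht : 0 < t) :
    (μ.prod μ) {p | t ≤ |f p.1 - f p.2|} ≤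
      ENNReal.ofReal (2 * Real.exp (-(((N : ℝ) - 2) * t ^ 2) / (48 * L ^ 2))) := by
  have h1 := one_sided μ hN f L hL hf t ht
  have h2 := one_sided μ hN (fun U => -f U) L hL (fun U V => by
    rw [← neg_sub_neg, abs_sub_comm]
    have := hf U V
    rw [abs_sub_comm] at this
    simpa [abs_sub_comm] using this) t ht
  have hsub : {p : UG N × UG N | t ≤ |f p.1 - f p.2|} ⊆
      {p | t ≤ f p.1 - f p.2} ∪ {p | t ≤ -f p.1 - -f p.2} := by
    intro p hp
    rcases le_abs.1 (show t ≤ |f p.1 - f p.2| from hp) with h | h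
    · exact Or.inl h
    · right; show t ≤ -f p.1 - -f p.2; linarith
  refine (measure_mono hsub).trans ((measure_union_le _ _).trans ((add_le_add h1 h2).trans ?_))
  rw [← ENNReal.ofReal_add (Real.exp_pos _).le (Real.exp_pos _).le, two_mul]

lemma final_bound [MeasurableSpace (UG N)] [BorelSpace (UG N)] (μ : Measure (UG N))
    [IsProbabilityMeasure μ] [μ.IsMulLeftInvariant]
    (L : ℝ) (hL : 0 < L) (t : ℝ) (ht : 0 < t) (X : Type*) [Fintype X] (f : X → UG N → ℝ)
    (hf : ∀ x, ∀ U V : UG N, |f x U - f x V| ≤ L * ‖(U : Mt N) - (V : Mt N)‖) :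
    (μ.prod μ) {p | ∃ x : X, t ≤ |f x p.1 - f x p.2|} ≤
      ENNReal.ofReal ((2 * Fintype.card X) *
        Real.exp (-(((N : ℝ) - 2) * t ^ 2) / (48 * L ^ 2))) := by
  rcases Nat.lt_or_ge N 3 with hN | hN
  · rcases isEmpty_or_nonempty X with hX | hX
    · simp
    · refine prob_le_one.trans ?_
      rw [← ENNReal.ofReal_one]
      refine ENNReal.ofReal_le_ofReal ?_
      have h1 : (1 : ℝ) ≤ Fintype.card X := by exact_mod_cast Fintype.card_pos
      have h2 : (N : ℝ) ≤ 2 := by exact_mod_cast Nat.lt_succ_iff.1 hN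
      have h3 : 0 ≤ -(((N : ℝ) - 2) * t ^ 2) / (48 * L ^ 2) := by
        refine div_nonneg ?_ (by positivity)
        nlinarith [sq_nonneg t]
      have h4 := Real.one_le_exp h3
      nlinarith
  · have hset : {p : UG N × UG N | ∃ x : X, t ≤ |f x p.1 - f x p.2|} =
        ⋃ x, {p | t ≤ |f x p.1 - f x p.2|} := by
      ext p; simp
    rw [hset]
    refine (measure_iUnion_fintype_le _ _).trans
      ((Finset.sum_le_sum fun x _ => two_sided μ hN (f x) L hL (hf x) t ht).trans ?_)
    rw [Finset.sum_const, Finset.card_univ, ← ENNReal.ofReal_nsmul]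
    refine le_of_eq (congrArg _ ?_)
    rw [nsmul_eq_mul]; ring

end
end UConc

/-- Let `N ≥ 1`, `L > 0`, `t > 0`, and let `X` be a finite index set, with
`f_x : U(N) → ℝ` `L`-Lipschitz with respect to the Frobenius norm for each `x ∈ X`. Then,
sampling `U, U'` independently from the Haar probability measure `μ_N` on the compact group
`U(N)` (formalized as a left-invariant Borel probability measure, which on `U(N)` is unique,
hence Haar),
`(μ_N × μ_N) {(U,U') : ∃ x, |f_x U − f_x U'| ≥ t} ≤ 2·|X|·exp(−(N−2)·t²/(48·L²))`. -/
theorem stmt_4 (N : ℕ) (hN : 0 < N)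
    [MeasurableSpace (Matrix.unitaryGroup (Fin N) ℂ)]
    [BorelSpace (Matrix.unitaryGroup (Fin N) ℂ)]
    (μ : Measure (Matrix.unitaryGroup (Fin N) ℂ)) [IsProbabilityMeasure μ]
    (hHaar : ∀ g : Matrix.unitaryGroup (Fin N) ℂ,
      MeasurePreserving (fun x => g * x) μ μ)
    (L : ℝ) (hL : 0 < L) (t : ℝ) (ht : 0 < t)
    (X : Type*) [Fintype X]
    (f : X → Matrix.unitaryGroup (Fin N) ℂ → ℝ)
    (hf : ∀ (x : X) (U V : Matrix.unitaryGroup (Fin N) ℂ),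
      |f x U - f x V| ≤
        L * frobNorm ((U : Matrix (Fin N) (Fin N) ℂ) - (V : Matrix (Fin N) (Fin N) ℂ))) :
    (μ.prod μ) {p | ∃ x : X, t ≤ |f x p.1 - f x p.2|} ≤
      ENNReal.ofReal ((2 * Fintype.card X) *
        Real.exp (-(((N : ℝ) - 2) * t ^ 2) / (48 * L ^ 2))) := by
  have : μ.IsMulLeftInvariant := ⟨fun g => (hHaar g).map_eq⟩
  refine UConc.final_bound μ L hL t ht X f fun x U V => ?_
  rw [← UConc.frobNorm_eq]
  exact hf x U V
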